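/- arXiv:1603.00936 — 6 statements merged into one kernel-verified Lean document; each statement's English description precedes it below -/
import Mathlib

section
/- Let 𝓓 be a family of d-subsets of [n] and 𝓔 a family of e-subsets of [n] which are cross-union. Then the colexicographic initial segments C^(d)(|𝓓|) and C^(e)(|𝓔|) are also cross-union. -/
/-- `F` strictly precedes `G` in the colexicographic order on finite sets of
positive integers: `max (F \ G) < max (G \ F)`. -/
def ColexLt (F G : Finset ℕ) : Prop := (F \ G).max < (G \ F).max

/-- `𝓒` is an initial segment of the colexicographic order on `k`-subsets of
`[n] = {1,…,n}`: it consists of `k`-subsets of `[n]` and is closed downwards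
under the colex order. -/
def IsColexSegment (n k : ℕ) (𝓒 : Finset (Finset ℕ)) : Prop :=
  (∀ F ∈ 𝓒, F ⊆ Finset.Icc 1 n ∧ F.card = k) ∧
    ∀ F : Finset ℕ, F ⊆ Finset.Icc 1 n → F.card = k →
      ∀ G ∈ 𝓒, ColexLt F G → F ∈ 𝓒

namespace Finset.Colex

open scoped FinsetFamily

lemma IsInitSeg.shadow_iterate {α : Type*} [LinearOrder α] [Finite α] {𝒜 : Finset (Finset α)}
    {r : ℕ} (h : IsInitSeg 𝒜 r) (k : ℕ) : IsInitSeg (∂^[k] 𝒜) (r - k) := by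
  induction k with
  | zero => simpa using h
  | succ k ih =>
    rw [Function.iterate_succ_apply', ← Nat.sub_sub]
    exact ih.shadow

lemma toColex_compl_lt_comm {α : Type*} [LinearOrder α] [Fintype α] {s t : Finset α} :
    toColex sᶜ < toColex t ↔ toColex tᶜ < toColex s := by
  simp only [toColex_lt_toColex_iff_exists_forall_lt, mem_compl, not_not]
  constructor <;> rintro ⟨a, h₁, h₂, h⟩ <;>
    exact ⟨a, h₂, h₁, fun b hb hb' ↦ h b hb' hb⟩

/-- If two families of subsets of `Fin n` are cross-union, then so are the initial segments of the
colexicographic order of the same sizes. -/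
theorem IsInitSeg.union_ne_univ {n d e : ℕ} {𝒮 𝒯 𝒜 ℬ : Finset (Finset (Fin n))}
    (h𝒮 : (𝒮 : Set (Finset (Fin n))).Sized d) (h𝒯 : (𝒯 : Set (Finset (Fin n))).Sized e)
    (hcu : ∀ D ∈ 𝒮, ∀ E ∈ 𝒯, D ∪ E ≠ univ) (h𝒜 : IsInitSeg 𝒜 d) (h𝒜𝒮 : #𝒜 = #𝒮)
    (hℬ : IsInitSeg ℬ e) (hℬ𝒯 : #ℬ = #𝒯) {F G : Finset (Fin n)} (hF : F ∈ 𝒜) (hG : G ∈ ℬ) :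
    F ∪ G ≠ univ := by
  intro hFG
  have hGF : Gᶜ ⊆ F := by
    intro x hx
    have : x ∈ F ∪ G := hFG ▸ mem_univ x
    grind [mem_compl]
  have hFd : #F = d := h𝒜.1 hF
  have hGe : #G = e := hℬ.1 hG
  have hGc : #Gᶜ = n - e := by rw [card_compl, Fintype.card_fin, hGe]
  have hed : n - e ≤ d := by rw [← hGc, ← hFd]; exact card_le_card hGF
  set k := d - (n - e)
  have hdk : d - k = n - e := by omega
  have hGmem : Gᶜ ∈ ∂^[k] 𝒜 := mem_shadow_iterate_iff_exists_sdiff.2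
    ⟨F, hF, hGF, by rw [card_sdiff_of_subset hGF, hFd, hGc]⟩
  have hseg : IsInitSeg (∂^[k] 𝒜) (n - e) := hdk ▸ h𝒜.shadow_iterate k
  have hcover : powersetCard (n - e) univ ⊆ ∂^[k] 𝒜 ∪ ℬᶜˢ := by
    intro t ht
    have htc : #t = n - e := (mem_powersetCard.1 ht).2
    rw [mem_union, mem_compls]
    obtain hlt | heq | hgt := lt_trichotomy (toColex t) (toColex Gᶜ)
    · exact .inl (hseg.2 hGmem ⟨hlt, htc⟩)
    · exact .inl (toColex_inj.1 heq ▸ hGmem)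
    · refine .inr (hℬ.2 hG ⟨toColex_compl_lt_comm.1 hgt, ?_⟩)
      have := card_le_univ G
      rw [Fintype.card_fin] at this
      rw [card_compl, Fintype.card_fin, htc]
      omega
  have hinter : 0 < #(∂^[k] 𝒜 ∩ ℬᶜˢ) :=
    card_pos.2 ⟨Gᶜ, mem_inter.2 ⟨hGmem, by simpa using hG⟩⟩
  have hdisj : Disjoint (∂^[k] 𝒮) 𝒯ᶜˢ := by
    rw [disjoint_left]
    intro t ht ht'
    obtain ⟨D, hD, htD, -⟩ := mem_shadow_iterate_iff_exists_sdiff.1 ht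
    refine hcu D hD tᶜ (mem_compls.1 ht') (eq_univ_of_forall fun x ↦ ?_)
    by_cases hx : x ∈ t
    · exact mem_union_left _ (htD hx)
    · exact mem_union_right _ (mem_compl.2 hx)
  have hsub : ∂^[k] 𝒮 ∪ 𝒯ᶜˢ ⊆ powersetCard (n - e) univ := by
    intro t ht
    refine mem_powersetCard.2 ⟨subset_univ _, ?_⟩
    obtain ht | ht := mem_union.1 ht
    · exact hdk ▸ h𝒮.shadow_iterate ht
    · simpa using h𝒯.compls ht
  have hkk : #(∂^[k] 𝒜) ≤ #(∂^[k] 𝒮) := iterated_kk h𝒮 h𝒜𝒮.le h𝒜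
  have h₁ := card_le_card hcover
  have h₂ := card_le_card hsub
  have h₃ := card_union_add_card_inter (∂^[k] 𝒜) ℬᶜˢ
  rw [card_union_of_disjoint hdisj, card_compls] at h₂
  rw [card_compls] at h₃
  omega

end Finset.Colex

lemma colexLt_of_toColex_lt {F G : Finset ℕ} (h : toColex F < toColex G) : ColexLt F G := by
  obtain ⟨a, haG, haF, hlt⟩ := Finset.Colex.toColex_lt_toColex_iff_exists_forall_lt.1 h
  refine lt_of_lt_of_le ?_ (Finset.le_max (Finset.mem_sdiff.2 ⟨haG, haF⟩))
  rw [Finset.max_eq_sup_withBot, Finset.sup_lt_iff (WithBot.bot_lt_coe a)]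
  intro b hb
  rw [Finset.mem_sdiff] at hb
  exact WithBot.coe_lt_coe.2 (hlt b hb.1 hb.2)

/-- The embedding of `Fin n` onto `{1, …, n}`. -/
def finSuccEmb (n : ℕ) : Fin n ↪ ℕ :=
  Fin.valEmbedding.trans ⟨Nat.succ, Nat.succ_injective⟩

lemma map_finSuccEmb_univ (n : ℕ) : Finset.univ.map (finSuccEmb n) = Finset.Icc 1 n := by
  ext x
  simp only [Finset.mem_map, Finset.mem_univ, true_and, Finset.mem_Icc]
  constructor
  · rintro ⟨i, rfl⟩
    exact ⟨Nat.succ_pos i, i.isLt⟩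
  · rintro ⟨h₁, h₂⟩
    exact ⟨⟨x - 1, by omega⟩, Nat.sub_add_cancel h₁⟩

lemma exists_map_finSuccEmb_eq {n : ℕ} {F : Finset ℕ} (hF : F ⊆ Finset.Icc 1 n) :
    ∃ s : Finset (Fin n), s.map (finSuccEmb n) = F := by
  rw [← map_finSuccEmb_univ, Finset.subset_map_iff] at hF
  obtain ⟨s, -, rfl⟩ := hF
  exact ⟨s, rfl⟩

/-- The family of subsets of `Fin n` corresponding to a family of subsets of `{1, …, n}`. -/
def pullFamily (n : ℕ) (𝒜 : Finset (Finset ℕ)) : Finset (Finset (Fin n)) :=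
  {s | s.map (finSuccEmb n) ∈ 𝒜}

lemma mem_pullFamily {n : ℕ} {𝒜 : Finset (Finset ℕ)} {s : Finset (Fin n)} :
    s ∈ pullFamily n 𝒜 ↔ s.map (finSuccEmb n) ∈ 𝒜 := by
  simp [pullFamily]

lemma card_pullFamily {n : ℕ} {𝒜 : Finset (Finset ℕ)} (h : ∀ F ∈ 𝒜, F ⊆ Finset.Icc 1 n) :
    (pullFamily n 𝒜).card = 𝒜.card := by
  refine Finset.card_bij (fun s _ ↦ s.map (finSuccEmb n)) (fun s hs ↦ mem_pullFamily.1 hs)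
    (fun s _ t _ hst ↦ Finset.map_injective _ hst) fun F hF ↦ ?_
  obtain ⟨s, rfl⟩ := exists_map_finSuccEmb_eq (h F hF)
  exact ⟨s, mem_pullFamily.2 hF, rfl⟩

lemma sized_pullFamily {n k : ℕ} {𝒜 : Finset (Finset ℕ)} (h : ∀ F ∈ 𝒜, F.card = k) :
    (pullFamily n 𝒜 : Set (Finset (Fin n))).Sized k := by
  intro s hs
  simpa using h _ (mem_pullFamily.1 hs)

lemma IsColexSegment.isInitSeg_pullFamily {n k : ℕ} {𝒜 : Finset (Finset ℕ)}
    (h : IsColexSegment n k 𝒜) : Finset.Colex.IsInitSeg (pullFamily n 𝒜) k := by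
  refine ⟨sized_pullFamily fun F hF ↦ (h.1 F hF).2, fun s t hs ⟨hlt, ht⟩ ↦ ?_⟩
  refine mem_pullFamily.2 (h.2 _ ?_ (by simpa using ht) _ (mem_pullFamily.1 hs)
    (colexLt_of_toColex_lt ?_))
  · rw [← map_finSuccEmb_univ]
    exact Finset.map_subset_map.2 (Finset.subset_univ t)
  · have hmono : StrictMono (finSuccEmb n) := fun _ _ hij ↦ Nat.succ_lt_succ hij
    rwa [Finset.map_eq_image, Finset.map_eq_image,
      Finset.Colex.toColex_image_lt_toColex_image hmono]

/-- Corollary to Hilton's Lemma: if `𝓓 ⊆ ([n] choose d)` and `𝓔 ⊆ ([n] choose e)`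
are cross-union, then the colex initial segments `C^(d)(|𝓓|)` and `C^(e)(|𝓔|)`
are cross-union as well. -/
theorem hilton_colex (n d e : ℕ)
    (𝓓 𝓔 𝓒d 𝓒e : Finset (Finset ℕ))
    (h𝓓 : ∀ D ∈ 𝓓, D ⊆ Finset.Icc 1 n ∧ D.card = d)
    (h𝓔 : ∀ E ∈ 𝓔, E ⊆ Finset.Icc 1 n ∧ E.card = e)
    (hcu : ∀ D ∈ 𝓓, ∀ E ∈ 𝓔, D ∪ E ≠ Finset.Icc 1 n)
    (h𝓒d : IsColexSegment n d 𝓒d) (h𝓒dcard : 𝓒d.card = 𝓓.card)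
    (h𝓒e : IsColexSegment n e 𝓒e) (h𝓒ecard : 𝓒e.card = 𝓔.card) :
    ∀ F ∈ 𝓒d, ∀ G ∈ 𝓒e, F ∪ G ≠ Finset.Icc 1 n := by
  intro F hF G hG hFG
  obtain ⟨s, rfl⟩ := exists_map_finSuccEmb_eq (h𝓒d.1 F hF).1
  obtain ⟨t, rfl⟩ := exists_map_finSuccEmb_eq (h𝓒e.1 G hG).1
  have key (u v : Finset (Fin n)) :
      u.map (finSuccEmb n) ∪ v.map (finSuccEmb n) = Finset.Icc 1 n ↔ u ∪ v = Finset.univ := by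
    rw [← Finset.map_union, ← map_finSuccEmb_univ, Finset.map_inj]
  refine Finset.Colex.IsInitSeg.union_ne_univ (𝒮 := pullFamily n 𝓓) (𝒯 := pullFamily n 𝓔)
    (sized_pullFamily fun D hD ↦ (h𝓓 D hD).2) (sized_pullFamily fun E hE ↦ (h𝓔 E hE).2)
    (fun D hD E hE h ↦ hcu _ (mem_pullFamily.1 hD) _ (mem_pullFamily.1 hE) ((key D E).2 h))
    h𝓒d.isInitSeg_pullFamily ?_ h𝓒e.isInitSeg_pullFamily ?_
    (mem_pullFamily.2 hF) (mem_pullFamily.2 hG) ((key s t).1 hFG)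
  · rw [card_pullFamily fun F hF ↦ (h𝓒d.1 F hF).1, card_pullFamily fun D hD ↦ (h𝓓 D hD).1, h𝓒dcard]
  · rw [card_pullFamily fun F hF ↦ (h𝓒e.1 F hF).1, card_pullFamily fun E hE ↦ (h𝓔 E hE).1, h𝓒ecard]
end

section
/- Let n, k be positive integers with n ≥ 2k, and let 𝓐 and 𝓑 be cross-intersecting families of k-subsets of [n] such that |𝓐|·|𝓑| = binom(n-1, k-1)². Then |𝓐| = |𝓑| = binom(n-1, k-1). -/
section BooleanLattice

open Finset

lemma sum_level {α : Type*} [Fintype α] (k : ℕ) :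
    ∑ S : Finset α, (if #S = k then (1 : ℝ) else 0) = (Fintype.card α).choose k := by
  rw [sum_boole, ← Fintype.card_finset_len, Fintype.card_subtype]

variable {α : Type*} [DecidableEq α]

/-- The up operator of the Boolean lattice: `(U f) T = ∑ x ∈ T, f (T \ {x})`. -/
def upOp : (Finset α → ℝ) →ₗ[ℝ] (Finset α → ℝ) where
  toFun f T := ∑ x ∈ T, f (T.erase x)
  map_add' f g := by ext T; simp [sum_add_distrib]
  map_smul' c f := by ext T; simp [mul_sum]

lemma upOp_apply (f : Finset α → ℝ) (T : Finset α) :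
    upOp f T = ∑ x ∈ T, f (T.erase x) := rfl

/-- The function `f` is supported on sets of size `j`. -/
def LevelSupported (j : ℕ) (f : Finset α → ℝ) : Prop := ∀ S, #S ≠ j → f S = 0

lemma LevelSupported.upOp {j : ℕ} {f : Finset α → ℝ} (hf : LevelSupported j f) :
    LevelSupported (j + 1) (upOp f) := by
  intro T hT
  refine sum_eq_zero fun x hx ↦ hf _ ?_
  have := card_erase_add_one hx
  lia

lemma LevelSupported.upOp_pow {j : ℕ} {f : Finset α → ℝ} (hf : LevelSupported j f) (m : ℕ) :
    LevelSupported (j + m) ((_root_.upOp ^ m) f) := by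
  induction m with
  | zero => simpa
  | succ m ih =>
    rw [pow_succ']
    exact ih.upOp

lemma upOp_pow_ne_zero {f : Finset α → ℝ} {m : ℕ} {T : Finset α}
    (h : (upOp ^ m) f T ≠ 0) : ∃ S ⊆ T, f S ≠ 0 := by
  induction m generalizing T with
  | zero => exact ⟨T, subset_rfl, by simpa using h⟩
  | succ m ih =>
    rw [pow_succ', Module.End.mul_apply, upOp_apply] at h
    obtain ⟨x, -, hx⟩ := exists_ne_zero_of_sum_ne_zero h
    obtain ⟨S, hS, hS'⟩ := ih hx
    exact ⟨S, hS.trans (erase_subset _ _), hS'⟩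

lemma upOp_pow_level (j m : ℕ) {T : Finset α} (hT : #T = j + m) :
    (upOp ^ m) (fun S ↦ if #S = j then (1 : ℝ) else 0) T =
      ∏ i ∈ range m, ((j + i + 1 : ℕ) : ℝ) := by
  induction m generalizing T with
  | zero => simpa using hT
  | succ m ih =>
    rw [pow_succ', Module.End.mul_apply, upOp_apply, prod_range_succ,
      sum_congr rfl fun x hx ↦ ih (by rw [card_erase_of_mem hx]; lia), sum_const, hT,
      nsmul_eq_mul, mul_comm]
    rfl

variable [Fintype α]

/-- The down operator of the Boolean lattice: `(D f) S = ∑ x ∉ S, f (S ∪ {x})`. -/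
def downOp (f : Finset α → ℝ) (S : Finset α) : ℝ := ∑ x ∈ Sᶜ, f (insert x S)

lemma sum_upOp_mul (f g : Finset α → ℝ) :
    ∑ T, upOp f T * g T = ∑ S, f S * downOp g S := by
  simp_rw [upOp_apply, downOp, sum_mul, mul_sum, sum_sigma']
  refine sum_bij' (fun p _ ↦ ⟨p.1.erase p.2, p.2⟩) (fun p _ ↦ ⟨insert p.2 p.1, p.2⟩)
    ?_ ?_ ?_ ?_ ?_
  · simp
  · simp
  · rintro ⟨T, x⟩ h
    simp_all [insert_erase]
  · rintro ⟨T, x⟩ h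
    simp_all
  · rintro ⟨T, x⟩ h
    simp_all [insert_erase]

lemma downOp_upOp (f : Finset α → ℝ) (S : Finset α) :
    downOp (upOp f) S =
      upOp (downOp f) S + ((Fintype.card α : ℝ) - 2 * #S) * f S := by
  have hd : downOp (upOp f) S =
      (#Sᶜ : ℝ) * f S + ∑ x ∈ Sᶜ, ∑ y ∈ S, f ((insert x S).erase y) := by
    rw [downOp, ← nsmul_eq_mul, ← sum_const, ← sum_add_distrib]
    refine sum_congr rfl fun x hx ↦ ?_
    rw [mem_compl] at hx
    rw [upOp_apply, sum_insert hx, erase_insert hx]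
  have hu : upOp (downOp f) S =
      (#S : ℝ) * f S + ∑ y ∈ S, ∑ x ∈ Sᶜ, f ((insert x S).erase y) := by
    rw [upOp_apply, ← nsmul_eq_mul, ← sum_const, ← sum_add_distrib]
    refine sum_congr rfl fun y hy ↦ ?_
    rw [downOp, compl_erase, sum_insert (by simpa using hy), insert_erase hy]
    congr 1
    refine sum_congr rfl fun x hx ↦ ?_
    rw [erase_insert_of_ne]
    rintro rfl
    exact mem_compl.1 hx hy
  rw [hd, hu, sum_comm, card_compl, Nat.cast_sub (card_le_univ S)]
  ring

lemma LevelSupported.downOp {j : ℕ} {f : Finset α → ℝ} (hf : LevelSupported (j + 1) f) :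
    LevelSupported j (downOp f) := by
  intro S hS
  refine sum_eq_zero fun x hx ↦ hf _ ?_
  rw [card_insert_of_notMem (mem_compl.1 hx)]
  lia

lemma LevelSupported.sum_upOp {j : ℕ} {f : Finset α → ℝ} (hf : LevelSupported j f) :
    ∑ T, _root_.upOp f T = ((Fintype.card α : ℝ) - j) * ∑ S, f S := by
  have h := sum_upOp_mul f fun _ ↦ 1
  simp only [mul_one] at h
  rw [h, mul_sum]
  refine sum_congr rfl fun S _ ↦ ?_
  by_cases hS : #S = j
  · simp only [_root_.downOp, sum_const, nsmul_eq_mul, card_compl, hS,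
      Nat.cast_sub (hS ▸ card_le_univ S)]
    ring
  · simp [hf S hS]

lemma LevelSupported.sum_downOp {j : ℕ} {f : Finset α → ℝ} (hf : LevelSupported j f) :
    ∑ S, _root_.downOp f S = j * ∑ T, f T := by
  have h := sum_upOp_mul (fun _ ↦ 1) f
  simp only [one_mul] at h
  rw [← h, mul_sum]
  refine sum_congr rfl fun T _ ↦ ?_
  by_cases hT : #T = j
  · simp [upOp_apply, hT]
  · simp [hf T hT]

lemma LevelSupported.sum_upOp_sq_eq {j : ℕ} {f : Finset α → ℝ} (hf : LevelSupported j f) :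
    ∑ T, _root_.upOp f T ^ 2 =
      ∑ S, _root_.downOp f S ^ 2 + ((Fintype.card α : ℝ) - 2 * j) * ∑ S, f S ^ 2 := by
  have h₁ := sum_upOp_mul f (_root_.upOp f)
  have h₂ := sum_upOp_mul (_root_.downOp f) f
  simp_rw [sq]
  rw [h₁, ← h₂, mul_sum, ← sum_add_distrib]
  refine sum_congr rfl fun S _ ↦ ?_
  by_cases hS : #S = j
  · rw [downOp_upOp, hS]
    ring
  · simp [hf S hS]

/-- Spectral gap of the up operator on functions on the `j`-th level with sum zero. -/
lemma LevelSupported.sum_upOp_sq_le {j : ℕ} (hj : j ≤ Fintype.card α) {f : Finset α → ℝ}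
    (hf : LevelSupported j f) (h0 : ∑ S, f S = 0) :
    ∑ T, _root_.upOp f T ^ 2 ≤ (j * ((Fintype.card α : ℝ) - j - 1)) * ∑ S, f S ^ 2 := by
  induction j generalizing f with
  | zero =>
    have hf' : f = 0 := by
      ext S
      rcases S.eq_empty_or_nonempty with rfl | hS
      · rw [sum_eq_single ∅ (fun S _ hS ↦ hf S (by simpa using hS)) (by simp)] at h0
        simpa using h0
      · exact hf S (by simpa using hS.ne_empty)
    simp [hf']
  | succ j ih =>
    have hg := hf.downOp
    have hg0 : ∑ S, _root_.downOp f S = 0 := by rw [hf.sum_downOp, h0, mul_zero]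
    have hu := ih (by lia) hg hg0
    have hcs := sum_mul_sq_le_sq_mul_sq univ (_root_.upOp (_root_.downOp f)) f
    rw [sum_upOp_mul] at hcs
    simp_rw [← sq] at hcs
    rw [hf.sum_upOp_sq_eq]
    set G := ∑ S, _root_.downOp f S ^ 2
    set F := ∑ S, f S ^ 2
    have hF : 0 ≤ F := sum_nonneg fun _ _ ↦ sq_nonneg _
    have hG : 0 ≤ G := sum_nonneg fun _ _ ↦ sq_nonneg _
    have hc : 0 ≤ (j : ℝ) * ((Fintype.card α : ℝ) - j - 1) := by
      have : ((j + 1 : ℕ) : ℝ) ≤ Fintype.card α := by exact_mod_cast hj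
      push_cast at this
      exact mul_nonneg (by positivity) (by linarith)
    have key : G ≤ (j * ((Fintype.card α : ℝ) - j - 1)) * F := by
      rcases hG.eq_or_lt with h | h
      · rw [← h]
        positivity
      · refine le_of_mul_le_mul_right ?_ h
        nlinarith [mul_le_mul_of_nonneg_right hu hF]
    push_cast
    linarith

lemma LevelSupported.sum_upOp_pow_eq_zero {j : ℕ} {f : Finset α → ℝ}
    (hf : LevelSupported j f) (h0 : ∑ S, f S = 0) (m : ℕ) :
    ∑ T, (_root_.upOp ^ m) f T = 0 := by
  induction m with
  | zero => simpa
  | succ m ih =>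
    rw [pow_succ', Module.End.mul_apply, (hf.upOp_pow m).sum_upOp, ih, mul_zero]

lemma LevelSupported.sum_upOp_pow_sq_le {j m : ℕ} (hj : j + m ≤ Fintype.card α)
    {f : Finset α → ℝ} (hf : LevelSupported j f) (h0 : ∑ S, f S = 0) :
    ∑ T, (_root_.upOp ^ m) f T ^ 2 ≤
      (∏ i ∈ range m, ((j + i : ℕ) : ℝ) * ((Fintype.card α - 1 - j - i : ℕ) : ℝ)) *
        ∑ S, f S ^ 2 := by
  induction m with
  | zero => simp
  | succ m ih =>
    have h := (hf.upOp_pow m).sum_upOp_sq_le (by lia) (hf.sum_upOp_pow_eq_zero h0 m)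
    rw [pow_succ', Module.End.mul_apply, prod_range_succ]
    have hc : ((Fintype.card α - 1 - j - m : ℕ) : ℝ) =
        (Fintype.card α : ℝ) - (j + m : ℕ) - 1 := by
      have : ((Fintype.card α - 1 - j - m + (j + m) + 1 : ℕ) : ℝ) = Fintype.card α := by
        congr 1
        lia
      rw [← this]
      push_cast
      ring
    rw [← hc] at h
    refine h.trans ?_
    refine (mul_le_mul_of_nonneg_left (ih (by lia)) (by positivity)).trans_eq ?_
    ring

/-- The indicator of a `k`-uniform family `A`, centred on the `k`-th level and scaled by
`(Fintype.card α).choose k`. -/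
noncomputable def centred (k : ℕ) (A : Finset (Finset α)) : Finset α → ℝ :=
  ((Fintype.card α).choose k : ℝ) • (fun S ↦ if S ∈ A then (1 : ℝ) else 0) -
    (#A : ℝ) • fun S ↦ if #S = k then (1 : ℝ) else 0

lemma centred_levelSupported {k : ℕ} {A : Finset (Finset α)} (hA : ∀ S ∈ A, #S = k) :
    LevelSupported k (centred k A) := by
  intro S hS
  have : S ∉ A := fun h ↦ hS (hA S h)
  simp [centred, hS, this]

lemma sum_centred (k : ℕ) (A : Finset (Finset α)) :
    ∑ S, centred k A S = 0 := by
  simp only [centred, Pi.sub_apply, Pi.smul_apply, smul_eq_mul, sum_sub_distrib, ← mul_sum,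
    sum_level]
  simp [mul_comm]

lemma sum_centred_sq {k : ℕ} {A : Finset (Finset α)} (hA : ∀ S ∈ A, #S = k) :
    ∑ S, centred k A S ^ 2 =
      (Fintype.card α).choose k * #A * ((Fintype.card α).choose k - #A) := by
  have h : ∀ S, centred k A S ^ 2 =
      ((Fintype.card α).choose k ^ 2 - 2 * (Fintype.card α).choose k * #A) *
        (if S ∈ A then (1 : ℝ) else 0) + (#A : ℝ) ^ 2 * (if #S = k then (1 : ℝ) else 0) := by
    intro S
    by_cases hS : S ∈ A
    · simp [centred, hS, hA S hS]
      ring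
    · by_cases hk : #S = k <;> simp [centred, hS, hk]
  simp only [h, sum_add_distrib, ← mul_sum, sum_level]
  simp
  ring

/-- The spectral bound for cross-intersecting families, in terms of the complements of the sets of
one of the two families. -/
lemma card_mul_card_mul_sq_le {k : ℕ} (hk : 0 < k) (hn : 2 * k ≤ Fintype.card α)
    {A C : Finset (Finset α)} (hA : ∀ S ∈ A, #S = k) (hC : ∀ T ∈ C, #T = Fintype.card α - k)
    (hAC : ∀ S ∈ A, ∀ T ∈ C, ¬ S ⊆ T) (hA0 : 0 < #A) (hC0 : 0 < #C) :
    (#A * #C : ℝ) * (Fintype.card α - k) ^ 2 ≤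
      k ^ 2 * (((Fintype.card α).choose k - #A) * ((Fintype.card α).choose k - #C)) := by
  set n := Fintype.card α
  set N : ℝ := (n.choose k : ℝ)
  have hN : 0 < N := Nat.cast_pos.2 (Nat.choose_pos (by lia))
  set m := n - 2 * k
  set P : ℝ := ∏ i ∈ range m, ((k + i : ℕ) : ℝ)
  set Q : ℝ := ∏ i ∈ range m, ((k + i + 1 : ℕ) : ℝ)
  have hP : 0 < P := prod_pos fun i _ ↦ Nat.cast_pos.2 (by lia)
  have hQP : (k : ℝ) * Q = (n - k) * P := by
    have h₁ := prod_range_succ (fun i ↦ ((k + i : ℕ) : ℝ)) m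
    have h₂ := prod_range_succ' (fun i ↦ ((k + i : ℕ) : ℝ)) m
    have h₃ : ((k + m : ℕ) : ℝ) = n - k := by
      have : k + m + k = n := by lia
      rw [← this]
      push_cast
      ring
    rw [h₃] at h₁
    simp only [add_zero, ← add_assoc] at h₂
    linarith
  have hf := centred_levelSupported hA
  have hf0 := sum_centred k A
  have hnorm := hf.sum_upOp_pow_sq_le (m := m) (by lia) hf0
  have hrefl : ∏ i ∈ range m, ((n - 1 - k - i : ℕ) : ℝ) = P := by
    rw [← prod_range_reflect]
    refine prod_congr rfl fun i hi ↦ ?_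
    rw [mem_range] at hi
    congr 1
    lia
  rw [prod_mul_distrib, hrefl, sum_centred_sq hA] at hnorm
  have hnormC := sum_centred_sq hC
  rw [Nat.choose_symm (show k ≤ n by lia)] at hnormC
  have hF0 := hf.sum_upOp_pow_eq_zero hf0 m
  have hFl := hf.upOp_pow m
  have hinner : ∑ T, (upOp ^ m) (centred k A) T * centred (n - k) C T =
      - (N * #A * #C * Q) := by
    have h : ∀ T, (upOp ^ m) (centred k A) T * centred (n - k) C T =
        (- (N * #A * Q)) * (if T ∈ C then (1 : ℝ) else 0) -
          #C * (upOp ^ m) (centred k A) T := by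
      intro T
      by_cases hT : #T = n - k
      · by_cases hTC : T ∈ C
        · have hval : (upOp ^ m) (centred k A) T = - (#A * Q) := by
            rw [centred, map_sub, map_smul, map_smul]
            have hz : (upOp ^ m) (fun S ↦ if S ∈ A then (1 : ℝ) else 0) T = 0 := by
              by_contra hne
              obtain ⟨S, hST, hS⟩ := upOp_pow_ne_zero hne
              exact hAC S (by by_contra h; simp [h] at hS) T hTC hST
            have hl := upOp_pow_level k m (show #T = k + m by lia)
            simp only [Pi.sub_apply, Pi.smul_apply, smul_eq_mul, hz, hl]
            ring
          have hc : centred (n - k) C T = N - #C := by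
            simp [centred, hTC, hT, N, n, Nat.choose_symm (show k ≤ n by lia)]
          rw [hval, hc, if_pos hTC]
          ring
        · have hc : centred (n - k) C T = - #C := by simp [centred, hTC, hT]
          rw [hc, if_neg hTC]
          ring
      · have hTC : T ∉ C := fun h ↦ hT (hC T h)
        rw [hFl T (by lia), if_neg hTC]
        ring
    simp only [h, sum_sub_distrib, ← mul_sum, hF0]
    simp
    ring
  have hcs := sum_mul_sq_le_sq_mul_sq univ ((upOp ^ m) (centred k A)) (centred (n - k) C)
  rw [hinner, hnormC] at hcs
  have ha : (0 : ℝ) < #A := by exact_mod_cast hA0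
  have hc : (0 : ℝ) < #C := by exact_mod_cast hC0
  have hcN : (0 : ℝ) ≤ N * #C * (N - #C) := by
    rw [← hnormC]
    exact sum_nonneg fun _ _ ↦ sq_nonneg _
  have hle := hcs.trans (mul_le_mul_of_nonneg_right hnorm hcN)
  have hpos : 0 < N ^ 2 * (#A * #C) * P ^ 2 := by positivity
  refine le_of_mul_le_mul_left ?_ hpos
  calc N ^ 2 * (#A * #C) * P ^ 2 * (#A * #C * (n - k) ^ 2)
      = N ^ 2 * (#A * #C) ^ 2 * ((n - k) * P) ^ 2 := by ring
    _ = k ^ 2 * (-(N * #A * #C * Q)) ^ 2 := by rw [← hQP]; ring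
    _ ≤ k ^ 2 * (P * P * (N * #A * (N - #A)) * (N * #C * (N - #C))) := by gcongr
    _ = _ := by ring

theorem card_eq_card_of_crossIntersecting {k : ℕ} (hk : 0 < k) (hn : 2 * k ≤ Fintype.card α)
    {A B : Finset (Finset α)} (hA : ∀ S ∈ A, #S = k) (hB : ∀ T ∈ B, #T = k)
    (hAB : ∀ S ∈ A, ∀ T ∈ B, ¬ Disjoint S T)
    (heq : #A * #B = (Fintype.card α - 1).choose (k - 1) ^ 2) : #A = #B := by
  set n := Fintype.card α
  set M := (n - 1).choose (k - 1)
  have hM : 0 < M := Nat.choose_pos (by lia)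
  have hpos : 0 < #A * #B := heq ▸ pow_pos hM 2
  have hNM : (k : ℝ) * n.choose k = n * M := by
    have h := Nat.add_one_mul_choose_eq (n - 1) (k - 1)
    rw [Nat.sub_add_cancel (by lia), Nat.sub_add_cancel hk, mul_comm (n.choose k)] at h
    exact_mod_cast h.symm
  have key := card_mul_card_mul_sq_le hk hn hA (C := B.image compl)
    (by
      simp only [mem_image, forall_exists_index, and_imp, forall_apply_eq_imp_iff₂]
      intro T hT
      rw [card_compl, hB T hT])
    (by
      simp only [mem_image, forall_exists_index, and_imp, forall_apply_eq_imp_iff₂]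
      intro S hS T hT h
      exact hAB S hS T hT (le_compl_iff_disjoint_right.1 h))
    (Nat.pos_of_mul_pos_right hpos)
    (by
      rw [card_image_of_injective _ compl_injective]
      exact Nat.pos_of_mul_pos_left hpos)
  rw [card_image_of_injective _ compl_injective] at key
  change _ * ((n : ℝ) - k) ^ 2 ≤ k ^ 2 * (((n.choose k : ℝ) - _) * ((n.choose k : ℝ) - _)) at key
  have heq' : (#A * #B : ℝ) = (M : ℝ) ^ 2 := by exact_mod_cast heq
  have hM' : (0 : ℝ) < M := by exact_mod_cast hM
  have hk' : (0 : ℝ) < k := by exact_mod_cast hk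
  have hn' : (0 : ℝ) < n := by
    have : 0 < n := by lia
    exact_mod_cast this
  have hexp : (k : ℝ) ^ 2 * (((n.choose k : ℝ) - #A) * (n.choose k - #B)) =
      (n * M) ^ 2 - k * (n * M) * (#A + #B) + k ^ 2 * M ^ 2 := by
    rw [← hNM, ← heq']
    ring
  rw [hexp, heq'] at key
  have hsum : (#A + #B : ℝ) ≤ 2 * M := by
    have : 0 < (k : ℝ) * n * M := by positivity
    refine le_of_mul_le_mul_left ?_ this
    linarith
  have hsq : ((#A : ℝ) - #B) ^ 2 ≤ 0 := by
    have h0 : (0 : ℝ) ≤ #A + #B := by positivity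
    nlinarith
  have := pow_eq_zero_iff (two_ne_zero) |>.1 (le_antisymm hsq (sq_nonneg _))
  exact_mod_cast sub_eq_zero.1 this

end BooleanLattice


/-- Equality in Pyber's inequality: if `𝓐, 𝓑` are cross-intersecting families of
`k`-subsets of `[n]`, `n ≥ 2k > 0`, and `|𝓐|·|𝓑| = binom(n-1,k-1)²`, then
`|𝓐| = |𝓑| = binom(n-1,k-1)`. -/
theorem pyber_equality (n k : ℕ) (hk : 0 < k) (hn : 2 * k ≤ n)
    (𝓐 𝓑 : Finset (Finset ℕ))
    (h𝓐 : ∀ A ∈ 𝓐, A ⊆ Finset.Icc 1 n ∧ A.card = k)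
    (h𝓑 : ∀ B ∈ 𝓑, B ⊆ Finset.Icc 1 n ∧ B.card = k)
    (hcross : ∀ A ∈ 𝓐, ∀ B ∈ 𝓑, (A ∩ B).Nonempty)
    (heq : 𝓐.card * 𝓑.card = ((n - 1).choose (k - 1)) ^ 2) :
    𝓐.card = (n - 1).choose (k - 1) ∧ 𝓑.card = (n - 1).choose (k - 1) := by
  have hinj : ∀ 𝓒 : Finset (Finset ℕ), (∀ C ∈ 𝓒, C ⊆ Finset.Icc 1 n ∧ C.card = k) →
      (𝓒.image fun C ↦ C.subtype (· ∈ Finset.Icc 1 n)).card = 𝓒.card := by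
    intro 𝓒 h𝓒
    refine Finset.card_image_of_injOn fun C hC D hD h ↦ ?_
    have h' := congrArg (Finset.map (Function.Embedding.subtype _)) h
    simpa only [Finset.subtype_map_of_mem (h𝓒 C hC).1, Finset.subtype_map_of_mem (h𝓒 D hD).1]
      using h'
  have hcard : ∀ 𝓒 : Finset (Finset ℕ), (∀ C ∈ 𝓒, C ⊆ Finset.Icc 1 n ∧ C.card = k) →
      ∀ S ∈ 𝓒.image fun C ↦ C.subtype (· ∈ Finset.Icc 1 n), S.card = k := by
    simp only [Finset.mem_image]
    rintro 𝓒 h𝓒 _ ⟨C, hC, rfl⟩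
    rw [Finset.card_subtype, Finset.filter_true_of_mem (h𝓒 C hC).1, (h𝓒 C hC).2]
  have hcardn : Fintype.card (Finset.Icc 1 n) = n := by simp
  have h := card_eq_card_of_crossIntersecting hk (by rwa [hcardn])
    (hcard 𝓐 h𝓐) (hcard 𝓑 h𝓑)
    (by
      simp only [Finset.mem_image]
      rintro _ ⟨A, hA, rfl⟩ _ ⟨B, hB, rfl⟩ hd
      obtain ⟨x, hx⟩ := hcross A hA B hB
      rw [Finset.mem_inter] at hx
      have hd' := Finset.disjoint_left.1 hd
      exact @hd' ⟨x, (h𝓐 A hA).1 hx.1⟩ (by simpa using hx.1)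
        (by simpa using hx.2))
    (by rw [hinj 𝓐 h𝓐, hinj 𝓑 h𝓑, hcardn, heq])
  rw [hinj 𝓐 h𝓐, hinj 𝓑 h𝓑] at h
  rw [← h, ← sq] at heq
  have := Nat.pow_left_injective two_ne_zero heq
  exact ⟨this, h ▸ this⟩
end

section
/- Let n, k, i be integers with n ≥ 2k > 0 and 3 ≤ i ≤ k+1, and let 𝓐 and 𝓑 be cross-intersecting families of k-subsets of [n] such that |𝓐| ≥ binom(n-2, k-2) + binom(n-i, k-i+1) and |𝓑| ≥ binom(n-1, k-1) + binom(n-i, k-i+1). Then |𝓐| + |𝓑| ≤ 2·binom(n-1, k-1) + binom(n-i, k-i+1) − binom(n-i, k-1). -/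
open Finset Finset.Colex
open scoped FinsetFamily

/-- `CrossPair m a b x y` says that there are cross-intersecting families of `a`-subsets and
`b`-subsets of an `m`-element set, of sizes `x` and `y` respectively. -/
def CrossPair (m a b x y : ℕ) : Prop :=
  ∃ 𝒜 ℬ : Finset (Finset (Fin m)),
    (∀ A ∈ 𝒜, #A = a) ∧ (∀ B ∈ ℬ, #B = b) ∧ #𝒜 = x ∧ #ℬ = y ∧
      ∀ A ∈ 𝒜, ∀ B ∈ ℬ, ¬ Disjoint A B

namespace CrossPair

variable {m a b x y : ℕ}

lemma swap (h : CrossPair m a b x y) : CrossPair m b a y x := by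
  obtain ⟨𝒜, ℬ, hA, hB, hx, hy, h⟩ := h
  exact ⟨ℬ, 𝒜, hB, hA, hy, hx, fun B hB A hA hd ↦ h A hA B hB hd.symm⟩

/-- Cross-intersecting families on any `m`-element ground set can be moved to `Fin m`. -/
lemma of_subset {α : Type*} [DecidableEq α] (s : Finset α) (hs : #s = m)
    {𝒜 ℬ : Finset (Finset α)} (hA : ∀ A ∈ 𝒜, A ⊆ s ∧ #A = a) (hB : ∀ B ∈ ℬ, B ⊆ s ∧ #B = b)
    (h : ∀ A ∈ 𝒜, ∀ B ∈ ℬ, ¬ Disjoint A B) : CrossPair m a b #𝒜 #ℬ := by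
  classical
  let e : Fin m ≃ s := (finCongr hs.symm).trans s.equivFin.symm
  let g : Fin m ↪ α := e.toEmbedding.trans (Function.Embedding.subtype _)
  have hg : ∀ z ∈ s, ∃ i, g i = z := fun z hz ↦ ⟨e.symm ⟨z, hz⟩, by simp [g]⟩
  let p : Finset α → Finset (Fin m) := fun A ↦ univ.filter (g · ∈ A)
  have hp : ∀ A ⊆ s, (p A).map g = A := by
    intro A hAs
    ext z
    simp only [p, mem_map, mem_filter, mem_univ, true_and]
    constructor
    · rintro ⟨i, hi, rfl⟩
      exact hi
    · intro hz
      obtain ⟨i, rfl⟩ := hg z (hAs hz)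
      exact ⟨i, hz, rfl⟩
  have hcard : ∀ A ⊆ s, #(p A) = #A := fun A hAs ↦ by
    rw [← card_map g, hp A hAs]
  have hinj : ∀ A ⊆ s, ∀ B ⊆ s, p A = p B → A = B := fun A hAs B hBs hAB ↦ by
    rw [← hp A hAs, hAB, hp B hBs]
  refine ⟨𝒜.image p, ℬ.image p, ?_, ?_, ?_, ?_, ?_⟩
  · simp only [mem_image, forall_exists_index, and_imp, forall_apply_eq_imp_iff₂]
    exact fun A h ↦ (hcard A (hA A h).1).trans (hA A h).2
  · simp only [mem_image, forall_exists_index, and_imp, forall_apply_eq_imp_iff₂]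
    exact fun A h ↦ (hcard A (hB A h).1).trans (hB A h).2
  · exact card_image_of_injOn fun A h B h' hAB ↦ hinj A (hA A h).1 B (hA B h').1 hAB
  · exact card_image_of_injOn fun A h B h' hAB ↦ hinj A (hB A h).1 B (hB B h').1 hAB
  · simp only [mem_image, forall_exists_index, and_imp, forall_apply_eq_imp_iff₂]
    intro A h1 B h2 hd
    apply h A h1 B h2
    rw [← hp A (hA A h1).1, ← hp B (hB B h2).1]
    exact (disjoint_map g).2 hd

end CrossPair

/-- The colex order on `r`-sets has initial segments of every possible size. -/
lemma exists_isInitSeg_card {α : Type*} [LinearOrder α] [Fintype α] (r N : ℕ)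
    (hN : N ≤ #(powersetCard r (univ : Finset α))) :
    ∃ 𝒞 : Finset (Finset α), IsInitSeg 𝒞 r ∧ #𝒞 = N := by
  classical
  induction N with
  | zero => exact ⟨∅, isInitSeg_empty, rfl⟩
  | succ N ih =>
    obtain ⟨𝒞, h𝒞, hc⟩ := ih (by lia)
    have hne : (powersetCard r (univ : Finset α) \ 𝒞).Nonempty := by
      rw [← card_pos]
      have := le_card_sdiff 𝒞 (powersetCard r (univ : Finset α))
      lia
    obtain ⟨s, hs, hmin⟩ := exists_min_image _ toColex hne
    simp only [mem_sdiff, mem_powersetCard_univ] at hs hmin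
    refine ⟨insert s 𝒞, ⟨?_, ?_⟩, by rw [card_insert_of_notMem hs.2, hc]⟩
    · intro t ht
      simp only [coe_insert, Set.mem_insert_iff, mem_coe] at ht
      obtain rfl | ht := ht
      · exact hs.1
      · exact h𝒞.1 ht
    · rintro u t hu ⟨htu, htr⟩
      rw [mem_insert] at hu ⊢
      by_contra! hcon
      obtain rfl | hu := hu
      · exact (hmin t ⟨htr, hcon.2⟩).not_gt htu
      · exact hcon.2 (h𝒞.2 hu ⟨htu, htr⟩)

/-- The number of `(a+1)`-subsets of `Fin (m+1)` containing the last element. -/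
lemma card_powersetCard_filter_last_mem (m a : ℕ) :
    #((powersetCard (a + 1) (univ : Finset (Fin (m + 1)))).filter (Fin.last m ∈ ·)) =
      m.choose a := by
  have hcard : #((univ : Finset (Fin (m + 1))).erase (Fin.last m)) = m := by simp
  conv_rhs => rw [← hcard, ← card_powersetCard]
  symm
  refine card_bij' (fun A _ ↦ insert (Fin.last m) A) (fun A _ ↦ A.erase (Fin.last m)) ?_ ?_ ?_ ?_
  · intro A hA
    simp only [mem_powersetCard, subset_erase] at hA
    simp [card_insert_of_notMem hA.1.2, hA.2]
  · intro A hA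
    simp only [mem_filter, mem_powersetCard_univ] at hA
    simp only [mem_powersetCard]
    exact ⟨erase_subset_erase _ (subset_univ _), by rw [card_erase_of_mem hA.2]; lia⟩
  · intro A hA
    simp only [mem_powersetCard, subset_erase] at hA
    exact erase_insert hA.1.2
  · intro A hA
    simp only [mem_filter] at hA
    exact insert_erase hA.2

namespace CrossPair

variable {m a b x y : ℕ}

/-- A form of Hilton's lemma: the first family can be taken to be comparable to the star centred
at the last element. -/
lemma exists_comparable_star (h : CrossPair (m + 1) a b x y) (hab : a + b ≤ m + 1) :
    ∃ 𝒜 ℬ : Finset (Finset (Fin (m + 1))),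
      (∀ A ∈ 𝒜, #A = a) ∧ (∀ B ∈ ℬ, #B = b) ∧ #𝒜 = x ∧ #ℬ = y ∧
        (∀ A ∈ 𝒜, ∀ B ∈ ℬ, ¬ Disjoint A B) ∧
          ((∀ A ∈ 𝒜, Fin.last m ∈ A) ∨ ∀ A, #A = a → Fin.last m ∈ A → A ∈ 𝒜) := by
  obtain ⟨𝒜, ℬ, hA, hB, hx, hy, hd⟩ := h
  have hsz : ((𝒜ᶜˢ : Finset (Finset (Fin (m + 1)))) : Set (Finset (Fin (m + 1)))).Sized
      (m + 1 - a) := by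
    intro A hA'
    have := hA _ (mem_compls.1 (mem_coe.1 hA'))
    have h2 := card_compl_add_card A
    rw [Fintype.card_fin] at h2
    lia
  obtain ⟨𝒞, h𝒞, hc⟩ := exists_isInitSeg_card (α := Fin (m + 1)) (m + 1 - a) #𝒜ᶜˢ
    (card_le_card fun A hA' ↦ mem_powersetCard_univ.2 (hsz hA'))
  have hkk := iterated_kk (k := m + 1 - a - b) hsz hc.le h𝒞
  have hdis : Disjoint ℬ (∂^[m + 1 - a - b] 𝒜ᶜˢ) := by
    rw [disjoint_right]
    intro S hS hSB
    rw [mem_shadow_iterate_iff_exists_sdiff] at hS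
    obtain ⟨C, hC, hSC, -⟩ := hS
    exact hd _ (mem_compls.1 hC) S hSB
      (disjoint_of_subset_right hSC disjoint_compl_left)
  have hle : ℬ ∪ ∂^[m + 1 - a - b] 𝒜ᶜˢ ⊆ powersetCard b univ := by
    intro S hS
    rw [mem_powersetCard_univ]
    obtain hS | hS := mem_union.1 hS
    · exact hB S hS
    · have := hsz.shadow_iterate (k := m + 1 - a - b) hS
      lia
  have hle' := card_le_card hle
  rw [card_union_of_disjoint hdis] at hle'
  have hsd := le_card_sdiff (∂^[m + 1 - a - b] 𝒞) (powersetCard b (univ : Finset (Fin (m + 1))))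
  obtain ⟨ℬ', hℬ', hcard⟩ := exists_subset_card_eq
    (show #ℬ ≤ #(powersetCard b univ \ ∂^[m + 1 - a - b] 𝒞) by lia)
  have h𝒞A : ∀ A ∈ 𝒞ᶜˢ, #A = a := by
    intro A hA'
    have := h𝒞.1 (mem_compls.1 hA')
    have h2 := card_compl_add_card A
    rw [Fintype.card_fin] at h2
    lia
  refine ⟨𝒞ᶜˢ, ℬ', h𝒞A, ?_, by rw [card_compls, hc, card_compls, hx], hcard.trans hy, ?_, ?_⟩
  · intro B hB'
    exact mem_powersetCard_univ.1 (mem_sdiff.1 (hℬ' hB')).1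
  · intro A hA' B hB' hAB
    have h1 := mem_sdiff.1 (hℬ' hB')
    refine h1.2 (mem_shadow_iterate_iff_exists_mem_card_add.2
      ⟨Aᶜ, mem_compls.1 hA', subset_compl_iff_disjoint_left.2 hAB, ?_⟩)
    have := h𝒞.1 (mem_compls.1 hA')
    have h2 := mem_powersetCard_univ.1 h1.1
    lia
  · by_contra! hcon
    obtain ⟨⟨A, hA', hlA⟩, S, hSa, hlS, hS⟩ := hcon
    refine hS (mem_compls.2 (h𝒞.2 (mem_compls.1 hA') ⟨?_, ?_⟩))
    · rw [toColex_lt_toColex_iff_exists_forall_lt]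
      refine ⟨Fin.last m, by simpa using hlA, by simpa using hlS, fun z _ hz ↦ ?_⟩
      refine lt_of_le_of_ne (Fin.le_last z) ?_
      rintro rfl
      exact hz (by simpa using hlA)
    · have h2 := card_compl_add_card S
      rw [Fintype.card_fin] at h2
      lia

/-- If the first family is at least as large as a star, then a star can be removed from it. -/
lemma exists_of_choose_le (h : CrossPair (m + 1) (a + 1) (b + 1) x y) (hab : a + b + 1 ≤ m)
    (hx : m.choose a ≤ x) :
    ∃ x', x = m.choose a + x' ∧ CrossPair m (a + 1) b x' y := by
  classical
  obtain ⟨𝒜, ℬ, hA, hB, rfl, rfl, hd, hstar⟩ := h.exists_comparable_star (by lia)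
  have hcs := card_powersetCard_filter_last_mem m a
  set 𝒮 := (powersetCard (a + 1) (univ : Finset (Fin (m + 1)))).filter (Fin.last m ∈ ·) with h𝒮
  have hsub : 𝒮 ⊆ 𝒜 := by
    obtain hs | hs := hstar
    · have : 𝒜 ⊆ 𝒮 := fun A hA' ↦ by simp [h𝒮, hA A hA', hs A hA']
      exact (eq_of_subset_of_card_le this (by lia)).ge
    · intro A hA'
      simp only [h𝒮, mem_filter, mem_powersetCard_univ] at hA'
      exact hs A hA'.1 hA'.2
  have hBl : ∀ B ∈ ℬ, Fin.last m ∈ B := by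
    intro B hB'
    by_contra hl
    have hc : a ≤ #(Bᶜ.erase (Fin.last m)) := by
      rw [card_erase_of_mem (by simpa using hl), card_compl, hB B hB', Fintype.card_fin]
      lia
    obtain ⟨T, hT, hTc⟩ := exists_subset_card_eq hc
    rw [subset_erase] at hT
    refine hd (insert (Fin.last m) T) (hsub ?_) B hB' ?_
    · simp [h𝒮, card_insert_of_notMem hT.2, hTc]
    · rw [disjoint_insert_left]
      exact ⟨hl, (subset_compl_iff_disjoint_right.1 hT.1)⟩
  refine ⟨#(𝒜 \ 𝒮), by rw [card_sdiff_of_subset hsub]; lia, ?_⟩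
  have hinj : #(ℬ.image fun B ↦ B.erase (Fin.last m)) = #ℬ := by
    refine card_image_of_injOn fun B h1 B' h2 he ↦ ?_
    rw [← insert_erase (hBl B h1), ← insert_erase (hBl B' h2)]
    exact congrArg _ he
  rw [← hinj]
  have hAl : ∀ A ∈ 𝒜 \ 𝒮, A ∈ 𝒜 ∧ Fin.last m ∉ A := by
    intro A hA'
    rw [mem_sdiff] at hA'
    refine ⟨hA'.1, fun hl ↦ hA'.2 ?_⟩
    simp [h𝒮, hA A hA'.1, hl]
  refine of_subset ((univ : Finset (Fin (m + 1))).erase (Fin.last m)) (by simp) ?_ ?_ ?_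
  · intro A hA'
    exact ⟨subset_erase.2 ⟨subset_univ _, (hAl A hA').2⟩, hA A (hAl A hA').1⟩
  · simp only [mem_image, forall_exists_index, and_imp, forall_apply_eq_imp_iff₂]
    intro B hB'
    refine ⟨erase_subset_erase _ (subset_univ _), ?_⟩
    rw [card_erase_of_mem (hBl B hB'), hB B hB']
    rfl
  · simp only [mem_image, forall_exists_index, and_imp, forall_apply_eq_imp_iff₂]
    intro A hA' B hB' hdis
    refine hd A (hAl A hA').1 B hB' ?_
    rw [← insert_erase (hBl B hB'), disjoint_insert_right]
    exact ⟨(hAl A hA').2, hdis⟩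

/-- If the first family is at most as large as a star, then it can be taken inside a star. -/
lemma exists_of_le_choose (h : CrossPair (m + 1) (a + 1) (b + 1) x y) (hab : a + b + 1 ≤ m)
    (hx : x ≤ m.choose a) :
    ∃ y', y ≤ m.choose b + y' ∧ CrossPair m a (b + 1) x y' := by
  classical
  obtain ⟨𝒜, ℬ, hA, hB, rfl, rfl, hd, hstar⟩ := h.exists_comparable_star (by lia)
  have hAl : ∀ A ∈ 𝒜, Fin.last m ∈ A := by
    obtain hs | hs := hstar
    · exact hs
    · have hsub : (powersetCard (a + 1) (univ : Finset (Fin (m + 1)))).filter (Fin.last m ∈ ·)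
          ⊆ 𝒜 := by
        intro A hA'
        simp only [mem_filter, mem_powersetCard_univ] at hA'
        exact hs A hA'.1 hA'.2
      have heq := eq_of_subset_of_card_le hsub
        (by rw [card_powersetCard_filter_last_mem]; exact hx)
      intro A hA'
      rw [← heq] at hA'
      exact (mem_filter.1 hA').2
  refine ⟨#(ℬ.filter (Fin.last m ∉ ·)), ?_, ?_⟩
  · rw [← card_filter_add_card_filter_not (s := ℬ) (Fin.last m ∈ ·)]
    gcongr
    rw [← card_powersetCard_filter_last_mem]
    gcongr
    exact fun B hB' ↦ mem_powersetCard_univ.2 (hB B hB')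
  have hinj : #(𝒜.image fun A ↦ A.erase (Fin.last m)) = #𝒜 := by
    refine card_image_of_injOn fun B h1 B' h2 he ↦ ?_
    rw [← insert_erase (hAl B h1), ← insert_erase (hAl B' h2)]
    exact congrArg _ he
  rw [← hinj]
  refine of_subset ((univ : Finset (Fin (m + 1))).erase (Fin.last m)) (by simp) ?_ ?_ ?_
  · simp only [mem_image, forall_exists_index, and_imp, forall_apply_eq_imp_iff₂]
    intro A hA'
    refine ⟨erase_subset_erase _ (subset_univ _), ?_⟩
    rw [card_erase_of_mem (hAl A hA'), hA A hA']
    rfl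
  · intro B hB'
    rw [mem_filter] at hB'
    exact ⟨subset_erase.2 ⟨subset_univ _, hB'.2⟩, hB B hB'.1⟩
  · simp only [mem_image, forall_exists_index, and_imp, forall_apply_eq_imp_iff₂]
    intro A hA' B hB' hdis
    rw [mem_filter] at hB'
    refine hd A hA' B hB'.1 ?_
    rw [← insert_erase (hAl A hA'), disjoint_insert_left]
    exact ⟨hB'.2, hdis⟩

lemma left_le (h : CrossPair m a b x y) : x ≤ m.choose a := by
  obtain ⟨𝒜, ℬ, hA, hB, rfl, rfl, hd⟩ := h
  calc #𝒜 ≤ #(powersetCard a (univ : Finset (Fin m))) :=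
        card_le_card fun A hA' ↦ mem_powersetCard_univ.2 (hA A hA')
    _ = m.choose a := by simp

lemma right_eq_zero (h : CrossPair m a b x y) (hab : a + b ≤ m) (hx : m.choose a ≤ x) :
    y = 0 := by
  obtain ⟨𝒜, ℬ, hA, hB, rfl, rfl, hd⟩ := h
  have heq : 𝒜 = powersetCard a (univ : Finset (Fin m)) :=
    eq_of_subset_of_card_le (fun A hA' ↦ mem_powersetCard_univ.2 (hA A hA')) (by simpa using hx)
  rw [card_eq_zero, eq_empty_iff_forall_notMem]
  intro B hB'
  have hc : a ≤ #Bᶜ := by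
    rw [card_compl, hB B hB', Fintype.card_fin]
    lia
  obtain ⟨T, hT, hTc⟩ := exists_subset_card_eq hc
  exact hd T (by simp [heq, hTc]) B hB' (subset_compl_iff_disjoint_right.1 hT)

end CrossPair

/-- Binomial coefficients increase towards the middle. -/
lemma choose_le_choose_of_add_le {n a b : ℕ} (hab : a ≤ b) (h : a + b ≤ n) :
    n.choose a ≤ n.choose b := by
  have key : ∀ c, a ≤ c → c ≤ n / 2 → n.choose a ≤ n.choose c := by
    intro c hac
    induction c, hac using Nat.le_induction with
    | base => exact fun _ ↦ le_rfl
    | succ c hac ih =>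
      exact fun hc ↦ (ih (by lia)).trans (Nat.choose_le_succ_of_lt_half_left (by lia))
  by_cases hb : b ≤ n / 2
  · exact key b hab hb
  · rw [← Nat.choose_symm (show b ≤ n by lia)]
    exact key _ (by lia) (by lia)

lemma choose_add_choose_le (r c b j : ℕ) (hcb : c + j ≤ b) (hr : c + b + 1 ≤ r) :
    (r + j).choose (c + j) + r.choose (b + 1) ≤ (r + j).choose (b + 1) + r.choose c := by
  induction j with
  | zero => simp [add_comm]
  | succ j ih =>
    have h1 := ih (by lia)
    have h2 : (r + j).choose (c + j + 1) ≤ (r + j).choose b :=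
      choose_le_choose_of_add_le (by lia) (by lia)
    rw [← add_assoc, ← add_assoc, Nat.choose_succ_succ' (r + j) (c + j),
      Nat.choose_succ_succ' (r + j) b]
    lia

namespace CrossPair

variable {m a b c r j x y : ℕ}

lemma add_le_choose (h : CrossPair m a b x y) (hab : a ≤ b) (hm : a + b ≤ m) :
    x + y ≤ m.choose b := by
  induction m generalizing a b x y with
  | zero =>
    have hx := h.left_le
    have hy := h.swap.left_le
    have h0 := h.right_eq_zero hm
    obtain ⟨rfl, rfl⟩ : a = 0 ∧ b = 0 := by lia
    simp only [Nat.choose_self] at *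
    lia
  | succ m ih =>
    have hx := h.left_le
    have hy := h.swap.left_le
    have h0 := h.right_eq_zero hm
    obtain _ | a := a
    · have : 0 < (m + 1).choose b := Nat.choose_pos (by lia)
      simp only [Nat.choose_zero_right] at *
      lia
    obtain ⟨b, rfl⟩ : ∃ b', b = b' + 1 := ⟨b - 1, by lia⟩
    have hsum := Nat.choose_succ_succ' m b
    obtain hx | hx := le_total (m.choose a) x
    · obtain ⟨x', rfl, h'⟩ := h.exists_of_choose_le (by lia) hx
      obtain hab | rfl : a + 1 ≤ b ∨ a = b := by lia
      · have h1 := ih h' hab (by lia)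
        have h2 : m.choose a ≤ m.choose (b + 1) :=
          choose_le_choose_of_add_le (by lia) (by lia)
        lia
      · have h1 := ih h'.swap (by lia) (by lia)
        lia
    · obtain ⟨y', hy', h'⟩ := h.exists_of_le_choose (by lia) hx
      have h1 := ih h' (by lia) (by lia)
      lia

/-- If the smaller sets form a family at least as large as a `j`-star, then the total size is
maximised by the `j`-star. -/
lemma add_add_choose_le (h : CrossPair (r + j) (c + j) b x y) (hcb : c + j < b)
    (hr : c + b ≤ r) (hx : r.choose c ≤ x) :
    x + y + r.choose b ≤ (r + j).choose b + r.choose c := by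
  induction j generalizing x y with
  | zero =>
    have h1 := h.left_le
    have h2 := h.right_eq_zero (by lia) hx
    simp only [add_zero] at *
    lia
  | succ j ih =>
    obtain ⟨b, rfl⟩ : ∃ b', b = b' + 1 := ⟨b - 1, by lia⟩
    have hsum := Nat.choose_succ_succ' (r + j) b
    rw [← add_assoc, ← add_assoc] at h
    rw [← add_assoc]
    obtain hx' | hx' := le_total ((r + j).choose (c + j)) x
    · obtain ⟨x', rfl, h'⟩ := h.exists_of_choose_le (by lia) hx'
      have h1 := h'.add_le_choose (by lia) (by lia)
      have h2 := choose_add_choose_le r c b j (by lia) (by lia)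
      lia
    · obtain ⟨y', hy', h'⟩ := h.exists_of_le_choose (by lia) hx'
      have h1 := ih h' (by lia) hx
      lia

/-- If cross-intersecting uniform families are both at least as large as a `(j+1)`-star, then the
total size is maximised when one of them is a `(j+1)`-star. -/
lemma add_add_choose_le_of_uniform (h : CrossPair (r + j + 1) (c + j + 1) (c + j + 1) x y)
    (hr : c + (c + j + 1) ≤ r) (hx : r.choose c ≤ x) (hy : r.choose c ≤ y) :
    x + y + r.choose (c + j + 1) ≤ (r + j + 1).choose (c + j + 1) + r.choose c := by
  have hsum := Nat.choose_succ_succ' (r + j) (c + j)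
  have key : ∀ {x y : ℕ}, CrossPair (r + j + 1) (c + j + 1) (c + j + 1) x y → r.choose c ≤ y →
      (r + j).choose (c + j) ≤ x →
      x + y + r.choose (c + j + 1) ≤ (r + j + 1).choose (c + j + 1) + r.choose c := by
    intro x y h hy hx
    obtain ⟨x', rfl, h'⟩ := h.exists_of_choose_le (by lia) hx
    have := h'.swap.add_add_choose_le (by lia) (by lia) hy
    lia
  by_cases h1 : (r + j).choose (c + j) ≤ x
  · exact key h hy h1
  by_cases h2 : (r + j).choose (c + j) ≤ y
  · have := key h.swap hx h2
    lia
  have := choose_add_choose_le r c (c + j) j le_rfl (by lia)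
  lia

end CrossPair


/-- Case 1 of the proof of Theorem 2: if `𝓐, 𝓑` are cross-intersecting families
of `k`-subsets of `[n]`, `n ≥ 2k > 0`, `3 ≤ i ≤ k+1`,
`|𝓐| ≥ binom(n-2,k-2) + binom(n-i,k-i+1)` and
`|𝓑| ≥ binom(n-1,k-1) + binom(n-i,k-i+1)`, then
`|𝓐| + |𝓑| ≤ 2·binom(n-1,k-1) + binom(n-i,k-i+1) − binom(n-i,k-1)`. -/
theorem thm2_case1 (n k i : ℕ) (hk : 0 < k) (hn : 2 * k ≤ n)
    (hi3 : 3 ≤ i) (hik : i ≤ k + 1)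
    (𝓐 𝓑 : Finset (Finset ℕ))
    (h𝓐 : ∀ A ∈ 𝓐, A ⊆ Finset.Icc 1 n ∧ A.card = k)
    (h𝓑 : ∀ B ∈ 𝓑, B ⊆ Finset.Icc 1 n ∧ B.card = k)
    (hcross : ∀ A ∈ 𝓐, ∀ B ∈ 𝓑, (A ∩ B).Nonempty)
    (hA_ge : (n - 2).choose (k - 2) + (n - i).choose (k + 1 - i) ≤ 𝓐.card)
    (hB_ge : (n - 1).choose (k - 1) + (n - i).choose (k + 1 - i) ≤ 𝓑.card) :
    𝓐.card + 𝓑.card ≤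
      2 * (n - 1).choose (k - 1) + (n - i).choose (k + 1 - i)
        - (n - i).choose (k - 1) := by
  obtain ⟨j, rfl⟩ : ∃ j, i = j + 3 := ⟨i - 3, by lia⟩
  obtain ⟨c, rfl⟩ : ∃ c, k = c + j + 2 := ⟨k - (j + 2), by lia⟩
  obtain ⟨r, rfl⟩ : ∃ r, n = r + j + 3 := ⟨n - (j + 3), by lia⟩
  have h : CrossPair (r + j + 3) (c + j + 2) (c + j + 2) #𝓐 #𝓑 :=
    CrossPair.of_subset (Finset.Icc 1 (r + j + 3)) (by simp) h𝓐 h𝓑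
      fun A hA B hB ↦ by
        rw [Finset.not_disjoint_iff_nonempty_inter]
        exact hcross A hA B hB
  have e1 : r + j + 3 - 1 = r + j + 2 := rfl
  have e2 : r + j + 3 - 2 = r + j + 1 := rfl
  have e3 : c + j + 2 - 1 = c + j + 1 := rfl
  have e4 : c + j + 2 - 2 = c + j := rfl
  have e5 : r + j + 3 - (j + 3) = r := by lia
  have e6 : c + j + 2 + 1 - (j + 3) = c := by lia
  rw [e2, e4, e5, e6] at hA_ge
  rw [e1, e3, e5, e6] at hB_ge
  rw [e1, e3, e5, e6]
  obtain ⟨y, hy, h₁⟩ := h.swap.exists_of_choose_le (by lia) ((Nat.le_add_right _ _).trans hB_ge)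
  obtain ⟨x, hx, h₂⟩ := h₁.swap.exists_of_choose_le (by lia) ((Nat.le_add_right _ _).trans hA_ge)
  have h₃ := h₂.add_add_choose_le_of_uniform (by lia) (by lia) (by lia)
  have hsum := Nat.choose_succ_succ' (r + j + 1) (c + j)
  lia
end

section
/- Let n, k be integers with n > 2k > 0, and let 𝓐 and 𝓑 be cross-intersecting families of k-subsets of [n] such that |𝓑| = binom(n-1, k-1) and the intersection of all members of 𝓑 is empty. Then |𝓐| ≤ binom(n-1, k-1) − binom(n-k-1, k-1). -/
namespace CrossIntersecting

open Finset Equiv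
open scoped Pointwise FinsetFamily

/-- The `b`-subsets of `V` that are disjoint from at least one member of `𝒬`. -/
def disjointSets {α : Type*} [DecidableEq α] (V : Finset α) (b : ℕ) (𝒬 : Finset (Finset α)) :
    Finset (Finset α) :=
  {E ∈ V.powersetCard b | ∃ F ∈ 𝒬, Disjoint E F}

section General

variable {α : Type*} [DecidableEq α] {V : Finset α} {b : ℕ} {𝒬 ℛ : Finset (Finset α)}

lemma mem_disjointSets {E : Finset α} :
    E ∈ disjointSets V b 𝒬 ↔ (E ⊆ V ∧ #E = b) ∧ ∃ F ∈ 𝒬, Disjoint E F := by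
  rw [disjointSets, mem_filter, mem_powersetCard]

lemma card_disjointSets_union_add_card_disjointSets_inter_le :
    #(disjointSets V b (𝒬 ∪ ℛ)) + #(disjointSets V b (𝒬 ∩ ℛ)) ≤
      #(disjointSets V b 𝒬) + #(disjointSets V b ℛ) := by
  rw [← card_union_add_card_inter (disjointSets V b 𝒬)]
  gcongr <;> intro E <;> simp only [mem_disjointSets, mem_union, mem_inter] <;> grind

lemma card_disjointSets_singleton {F : Finset α} (hF : F ⊆ V) :
    #(disjointSets V b {F}) = (#V - #F).choose b := by
  rw [← card_sdiff_of_subset hF, ← card_powersetCard]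
  congr 1
  ext E
  simp only [mem_disjointSets, mem_singleton, exists_eq_left, mem_powersetCard, subset_sdiff]
  tauto

lemma exists_perm_smul_eq {A B : Finset α} (h : #A = #B) : ∃ σ : Perm α, σ • A = B := by
  obtain ⟨σ, hσ⟩ := (Set.powersetCard.isPretransitive (α := α) (n := #B)).exists_smul_eq
    ⟨A, h⟩ ⟨B, rfl⟩
  exact ⟨σ, congrArg Subtype.val hσ⟩

end General

section Fintype

variable {α : Type*} [DecidableEq α] [Fintype α]

lemma disjointSets_smul (σ : Perm α) (b : ℕ) (𝒬 : Finset (Finset α)) :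
    disjointSets univ b (σ • 𝒬) = σ • disjointSets univ b 𝒬 := by
  ext E
  rw [← inv_smul_mem_iff]
  simp only [mem_disjointSets, subset_univ, true_and, card_smul_finset, mem_smul_finset,
    exists_exists_and_eq_and]
  refine and_congr_right fun _ => exists_congr fun F => and_congr_right fun _ => ?_
  rw [disjoint_iff_inter_eq_empty, disjoint_iff_inter_eq_empty,
    ← smul_finset_eq_empty (a := σ⁻¹), smul_finset_inter, inv_smul_smul]

/-- If `A ≠ B` are `j`-sets in a ground set of more than `2j` points, then no proper nonempty
family of `j`-sets treats all the pairs `σ • A, σ • B` alike. -/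
lemma exists_perm_separating {j : ℕ} (hj : 2 * j < Fintype.card α) {A B : Finset α}
    (hA : #A = j) (hB : #B = j) (hAB : A ≠ B) {ℛ : Finset (Finset α)}
    (h₁ : ∃ E ∈ ℛ, #E = j) (h₂ : ∃ E ∉ ℛ, #E = j) :
    ∃ σ : Perm α, ¬ (σ • A ∈ ℛ ↔ σ • B ∈ ℛ) := by
  by_contra! H
  obtain ⟨a, ha, haB⟩ : ∃ a ∈ A, a ∉ B := by
    by_contra! h
    exact hAB (eq_of_subset_of_card_le h (by omega))
  obtain ⟨z, hz⟩ : ∃ z, z ∉ A ∪ B := by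
    by_contra! h
    have := card_union_le A B
    rw [eq_univ_iff_forall.2 h, card_univ] at this
    omega
  rw [mem_union, not_or] at hz
  have fixes : ∀ {C : Finset α} {u w : α}, (u ∈ C ↔ w ∈ C) → swap u w • C = C := by
    intro C u w h
    ext x
    rw [← inv_smul_mem_iff, swap_inv, Perm.smul_def, swap_apply_def]
    split_ifs <;> simp_all
  have key : ∀ σ : Perm α, (σ * swap a z) • A ∈ ℛ ↔ σ • A ∈ ℛ := by
    intro σ
    rw [H, H, mul_smul, fixes (by simp [haB, hz.2])]
  have cross : ∀ (u w : α), u ∈ A → w ∉ A → ∀ σ : Perm α,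
      (σ * swap u w) • A ∈ ℛ ↔ σ • A ∈ ℛ := by
    intro u w hu hw σ
    have haz : a ≠ z := ne_of_mem_of_not_mem ha hz.1
    have haw : a ≠ w := ne_of_mem_of_not_mem ha hw
    have huw : u ≠ w := ne_of_mem_of_not_mem hu hw
    have e : swap u w = swap a u * swap z w * swap a z * (swap z w * swap a u) := by
      have h1 : (swap a u * swap z w)⁻¹ = swap z w * swap a u := by simp
      have h2 : (swap a u * swap z w) a = u := by
        rw [Perm.mul_apply, swap_apply_of_ne_of_ne (x := a) haz haw, swap_apply_left]
      have h3 : (swap a u * swap z w) z = w := by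
        rw [Perm.mul_apply, swap_apply_left, swap_apply_of_ne_of_ne haw.symm huw.symm]
      rw [← h1, ← Equiv.swap_apply_apply, h2, h3]
    have f : (swap z w * swap a u) • A = A := by
      rw [mul_smul, fixes (iff_of_true ha hu), fixes (iff_of_false hz.1 hw)]
    have g : (swap a u * swap z w) • A = A := by
      rw [mul_smul, fixes (iff_of_false hz.1 hw), fixes (iff_of_true ha hu)]
    rw [e, ← mul_assoc, mul_smul, f, ← mul_assoc, key, mul_smul, g]
  have all : ∀ σ : Perm α, σ • A ∈ ℛ ↔ A ∈ ℛ := by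
    intro σ
    induction σ using Perm.swap_induction_on' with
    | one => simp
    | mul_swap σ u w _ ih =>
      rw [← ih]
      by_cases hu : u ∈ A <;> by_cases hw : w ∈ A
      · rw [mul_smul, fixes (by simp [hu, hw])]
      · exact cross u w hu hw σ
      · rw [swap_comm]
        exact cross w u hw hu σ
      · rw [mul_smul, fixes (by simp [hu, hw])]
  obtain ⟨E, hE, hEj⟩ := h₁
  obtain ⟨F, hF, hFj⟩ := h₂
  obtain ⟨σ, rfl⟩ := exists_perm_smul_eq (hA.trans hEj.symm)
  obtain ⟨τ, rfl⟩ := exists_perm_smul_eq (hA.trans hFj.symm)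
  rw [all] at hE hF
  exact hF hE

lemma card_disjointSets_add_card_disjointSets_univ {j : ℕ} (hj : 2 * j < Fintype.card α)
    {𝒬 ℛ : Finset (Finset α)} (h𝒬 : 𝒬 ⊆ univ.powersetCard j) (hℛ : ℛ ⊆ univ.powersetCard j)
    (h𝒬n : 𝒬.Nonempty) (hℛn : ℛ.Nonempty) (hcard : #𝒬 + #ℛ = (Fintype.card α).choose j) :
    (Fintype.card α).choose j + (Fintype.card α - j).choose j ≤
      #(disjointSets univ j 𝒬) + #(disjointSets univ j ℛ) := by
  induction hq : #𝒬 using Nat.strong_induction_on generalizing 𝒬 ℛ with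
  | _ q ih =>
  have hne : ∃ E ∉ ℛ, #E = j := by
    by_contra! h
    have : univ.powersetCard j ⊆ ℛ := by
      intro E hE
      by_contra hEℛ
      exact h E hEℛ (mem_powersetCard.1 hE).2
    have := card_le_card this
    have := h𝒬n.card_pos
    rw [card_powersetCard, card_univ] at *
    omega
  have hex : ∃ E ∈ ℛ, #E = j := by
    obtain ⟨E, hE⟩ := hℛn
    exact ⟨E, hE, (mem_powersetCard.1 (hℛ hE)).2⟩
  rcases eq_or_ne q 1 with rfl | hq1
  · obtain ⟨F, rfl⟩ := card_eq_one.1 hq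
    have hF : #F = j := (mem_powersetCard.1 (h𝒬 (mem_singleton_self F))).2
    have hj0 : j ≠ 0 := by
      rintro rfl
      have := hℛn.card_pos
      simp at hcard
      simp_all
    rw [card_disjointSets_singleton (subset_univ F), hF, card_univ, add_comm]
    gcongr
    rw [← card_univ, ← card_powersetCard]
    refine card_le_card fun E hE => ?_
    rw [mem_powersetCard] at hE
    refine mem_disjointSets.2 ⟨hE, ?_⟩
    by_contra! h
    have hsub : Eᶜ.powersetCard j ⊆ univ.powersetCard j \ ℛ := by
      intro G hG
      rw [mem_powersetCard] at hG
      rw [mem_sdiff, mem_powersetCard]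
      refine ⟨⟨subset_univ _, hG.2⟩, fun hGR => h G hGR ?_⟩
      exact (disjoint_compl_right (a := E)).mono_right hG.1
    have h1 := card_le_card hsub
    rw [card_sdiff_of_subset hℛ, card_powersetCard, card_powersetCard, card_univ, card_compl,
      hE.2, ← hcard, hq, Nat.add_sub_cancel] at h1
    have h2 : (j + 1).choose j ≤ (Fintype.card α - j).choose j :=
      Nat.choose_le_choose _ (by omega)
    rw [Nat.choose_succ_self_right] at h2
    omega
  · obtain ⟨A, hA, B, hB, hAB⟩ := one_lt_card.1
      (show 1 < #𝒬 by have := h𝒬n.card_pos; omega)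
    obtain ⟨σ, hσ⟩ := exists_perm_separating hj (mem_powersetCard.1 (h𝒬 hA)).2
      (mem_powersetCard.1 (h𝒬 hB)).2 hAB hex hne
    have hAσ : σ • A ∈ σ • 𝒬 := smul_mem_smul_finset hA
    have hBσ : σ • B ∈ σ • 𝒬 := smul_mem_smul_finset hB
    have hsub : σ • 𝒬 ⊆ univ.powersetCard j := by
      intro E hE
      obtain ⟨F, hF, rfl⟩ := mem_smul_finset.1 hE
      simpa using h𝒬 hF
    have hu := card_union_add_card_inter (σ • 𝒬) ℛ
    have hsm : #(σ • 𝒬) = #𝒬 := card_smul_finset σ 𝒬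
    have hlt : #(σ • 𝒬 ∩ ℛ) < q := by
      rw [← hq, ← hsm]
      refine card_lt_card ⟨inter_subset_left, fun h => hσ ?_⟩
      have h1 := h hAσ
      have h2 := h hBσ
      rw [mem_inter] at h1 h2
      exact iff_of_true h1.2 h2.2
    have := ih _ hlt (𝒬 := σ • 𝒬 ∩ ℛ) (ℛ := σ • 𝒬 ∪ ℛ) (inter_subset_left.trans hsub)
      (union_subset hsub hℛ) (by
        by_contra h
        rw [not_nonempty_iff_eq_empty] at h
        refine hσ (iff_of_false ?_ ?_) <;> intro h' <;>
          exact notMem_empty _ (h ▸ mem_inter.2 ⟨‹_›, h'⟩))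
      (hℛn.mono subset_union_right) (by omega) rfl
    have h3 := card_disjointSets_union_add_card_disjointSets_inter_le (V := univ) (b := j)
      (𝒬 := σ • 𝒬) (ℛ := ℛ)
    rw [disjointSets_smul σ j 𝒬, card_smul_finset] at h3
    omega

end Fintype

/-- The sets over `β` whose image under `e` belongs to `𝒬`. -/
def pullback {α β : Type*} [DecidableEq α] [Fintype β] (e : β ↪ α) (𝒬 : Finset (Finset α)) :
    Finset (Finset β) :=
  {s | s.map e ∈ 𝒬}

section Pullback

variable {α β : Type*} [DecidableEq α] [Fintype β] {e : β ↪ α}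
  {𝒬 : Finset (Finset α)} {a b : ℕ}

lemma mem_pullback {s : Finset β} : s ∈ pullback e 𝒬 ↔ s.map e ∈ 𝒬 := by
  simp [pullback]

lemma card_pullback (h : 𝒬 ⊆ (univ.map e).powersetCard a) : #(pullback e 𝒬) = #𝒬 := by
  rw [← card_map (mapEmbedding e).toEmbedding]
  congr 1
  ext F
  simp only [mem_map, mem_pullback, RelEmbedding.coe_toEmbedding, mapEmbedding_apply]
  constructor
  · rintro ⟨s, hs, rfl⟩
    exact hs
  · intro hF
    obtain ⟨s, -, rfl⟩ := subset_map_iff.1 (mem_powersetCard.1 (h hF)).1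
    exact ⟨s, hF, rfl⟩

lemma pullback_subset_powersetCard (h : 𝒬 ⊆ (univ.map e).powersetCard a) :
    pullback e 𝒬 ⊆ univ.powersetCard a := by
  intro s hs
  simpa using (mem_powersetCard.1 (h (mem_pullback.1 hs))).2

lemma card_disjointSets_pullback [DecidableEq β] (h : 𝒬 ⊆ (univ.map e).powersetCard a) :
    #(disjointSets univ b (pullback e 𝒬)) = #(disjointSets (univ.map e) b 𝒬) := by
  rw [← card_pullback (e := e) (𝒬 := disjointSets (univ.map e) b 𝒬) (a := b) (filter_subset _ _)]
  congr 1
  ext s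
  simp only [mem_disjointSets, mem_pullback, card_map, map_subset_map]
  refine and_congr_right fun _ => ⟨?_, ?_⟩
  · rintro ⟨t, ht, hst⟩
    exact ⟨t.map e, ht, (disjoint_map e).2 hst⟩
  · rintro ⟨F, hF, hsF⟩
    obtain ⟨t, -, rfl⟩ := subset_map_iff.1 (mem_powersetCard.1 (h hF)).1
    exact ⟨t, hF, (disjoint_map e).1 hsF⟩

end Pullback

lemma exists_embedding_map_univ {α : Type*} (V : Finset α) {N : ℕ} (hV : #V = N) :
    ∃ e : Fin N ↪ α, univ.map e = V := by
  refine ⟨(V.equivFinOfCardEq hV).symm.toEmbedding.trans (Function.Embedding.subtype _), ?_⟩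
  rw [← map_map, map_univ_equiv, univ_eq_attach, attach_map_val]

lemma card_disjointSets_add_card_disjointSets {α : Type*} [DecidableEq α] {V : Finset α} {j : ℕ}
    (hj : 2 * j < #V) {𝒬 ℛ : Finset (Finset α)}
    (h𝒬 : 𝒬 ⊆ V.powersetCard j) (hℛ : ℛ ⊆ V.powersetCard j)
    (h𝒬n : 𝒬.Nonempty) (hℛn : ℛ.Nonempty) (hcard : #𝒬 + #ℛ = (#V).choose j) :
    (#V).choose j + (#V - j).choose j ≤ #(disjointSets V j 𝒬) + #(disjointSets V j ℛ) := by
  obtain ⟨e, he⟩ := exists_embedding_map_univ V rfl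
  rw [← he] at h𝒬 hℛ
  have h := card_disjointSets_add_card_disjointSets_univ (α := Fin #V) (j := j) (by simpa)
    (pullback_subset_powersetCard h𝒬) (pullback_subset_powersetCard hℛ)
    (card_pos.1 (by rw [card_pullback h𝒬]; exact h𝒬n.card_pos))
    (card_pos.1 (by rw [card_pullback hℛ]; exact hℛn.card_pos))
    (by rw [card_pullback h𝒬, card_pullback hℛ, hcard, Fintype.card_fin])
  rwa [card_disjointSets_pullback h𝒬, card_disjointSets_pullback hℛ, he, Fintype.card_fin] at h

lemma disjointSets_eq_shadow_iterate {α : Type*} [DecidableEq α] [Fintype α] {a b : ℕ}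
    (hab : a + b ≤ Fintype.card α) {𝒬 : Finset (Finset α)} (h𝒬 : 𝒬 ⊆ univ.powersetCard a) :
    disjointSets univ b 𝒬 = shadow^[Fintype.card α - a - b] 𝒬ᶜˢ := by
  ext E
  rw [mem_shadow_iterate_iff_exists_mem_card_add, exists_compls_iff, mem_disjointSets]
  simp only [subset_univ, true_and, subset_compl_iff_disjoint_right, card_compl]
  constructor
  · rintro ⟨hE, F, hF, hEF⟩
    have := (mem_powersetCard.1 (h𝒬 hF)).2
    exact ⟨F, hF, hEF, by omega⟩
  · rintro ⟨F, hF, hEF, hc⟩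
    have := (mem_powersetCard.1 (h𝒬 hF)).2
    exact ⟨by omega, F, hF, hEF⟩

lemma exists_isInitSeg_card_eq {α : Type*} [LinearOrder α] [Fintype α] {r q : ℕ}
    (hq : q ≤ (Fintype.card α).choose r) :
    ∃ 𝒞 : Finset (Finset α), Colex.IsInitSeg 𝒞 r ∧ #𝒞 = q := by
  induction hq using Nat.decreasingInduction with
  | self =>
    refine ⟨univ.powersetCard r, ⟨Set.sized_powersetCard _ _, fun s t _ h => ?_⟩, by simp⟩
    simpa using h.2
  | of_succ q _ ih =>
    obtain ⟨𝒞, h𝒞, hcard⟩ := ih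
    obtain ⟨s, rfl, rfl⟩ := h𝒞.exists_initSeg (card_pos.1 (by omega))
    refine ⟨(Colex.initSeg s).erase s, ⟨fun t ht => h𝒞.1 (mem_of_mem_erase ht), ?_⟩, ?_⟩
    · rintro t u ht ⟨hut, hu⟩
      have ht' := mem_of_mem_erase ht
      refine mem_erase.2 ⟨?_, h𝒞.2 ht' ⟨hut, hu⟩⟩
      rintro rfl
      exact hut.not_ge (Colex.mem_initSeg.1 ht').2
    · rw [card_erase_of_mem (Colex.mem_initSeg.2 ⟨rfl, le_rfl⟩), hcard, Nat.add_sub_cancel]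

lemma isInitSeg_powersetCard_erase_last (M r : ℕ) :
    Colex.IsInitSeg ((univ.erase (Fin.last M)).powersetCard r) r := by
  refine ⟨Set.sized_powersetCard _ _, fun s t hs ⟨hts, ht⟩ => ?_⟩
  rw [mem_powersetCard] at hs ⊢
  refine ⟨fun x hx => ?_, ht⟩
  rw [mem_erase, ← Fin.lt_last_iff_ne_last]
  refine ⟨Colex.forall_lt_mono hts.le (fun y hy => ?_) x hx, mem_univ _⟩
  exact Fin.lt_last_iff_ne_last.2 (mem_erase.1 (hs.1 hy)).1

/-- A form of the Kruskal–Katona theorem: one may replace a family by one that is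
comparable with the star of all sets containing the last point. -/
lemma exists_card_disjointSets_le {M a b : ℕ} (hab : a + b ≤ M + 1)
    {𝒬 : Finset (Finset (Fin (M + 1)))} (h𝒬 : 𝒬 ⊆ univ.powersetCard a) :
    ∃ 𝒬₀ ⊆ univ.powersetCard a, #𝒬₀ = #𝒬 ∧
      #(disjointSets univ b 𝒬₀) ≤ #(disjointSets univ b 𝒬) ∧
      ((∀ F ∈ 𝒬₀, Fin.last M ∈ F) ∨ ∀ F, #F = a → Fin.last M ∈ F → F ∈ 𝒬₀) := by
  have haM : a ≤ M + 1 := by omega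
  have hq : #𝒬 ≤ (M + 1).choose (M + 1 - a) := by
    rw [Nat.choose_symm haM]
    simpa using card_le_card h𝒬
  obtain ⟨𝒞, h𝒞, hcard⟩ := exists_isInitSeg_card_eq (α := Fin (M + 1)) (by simpa using hq)
  have hs : 𝒞ᶜˢ ⊆ univ.powersetCard a := by
    intro F hF
    have h1 := h𝒞.1 (mem_coe.2 (mem_compls.1 hF))
    have h2 := card_le_univ F
    rw [card_compl] at h1
    rw [Fintype.card_fin] at h1 h2
    rw [mem_powersetCard]
    exact ⟨subset_univ _, by omega⟩
  refine ⟨𝒞ᶜˢ, hs, by rw [card_compls, hcard], ?_, ?_⟩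
  · rw [disjointSets_eq_shadow_iterate (by simpa) hs, disjointSets_eq_shadow_iterate (by simpa) h𝒬,
      compls_compls]
    refine iterated_kk (r := M + 1 - a) ?_ (by rw [card_compls, hcard]) h𝒞
    simpa using Set.Sized.compls (subset_powersetCard_univ_iff.1 h𝒬)
  · rcases h𝒞.total (isInitSeg_powersetCard_erase_last M (M + 1 - a)) with h | h
    · left
      intro F hF
      by_contra hF'
      have := (mem_powersetCard.1 (h (mem_compls.1 hF))).1 (mem_compl.2 hF')
      simp at this
    · right
      intro F hFa hF
      refine mem_compls.2 (h (mem_powersetCard.2 ⟨fun x hx => ?_, ?_⟩))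
      · rw [mem_erase]
        refine ⟨?_, mem_univ _⟩
        rintro rfl
        exact mem_compl.1 hx hF
      · rw [card_compl, Fintype.card_fin, hFa]

lemma card_disjointSets_add_card_disjointSets_fin {M j : ℕ} (hj : 2 * j + 1 ≤ M)
    {𝒬 𝒳 : Finset (Finset (Fin (M + 1)))}
    (h𝒬 : 𝒬 ⊆ univ.powersetCard (j + 1)) (h𝒳 : 𝒳 ⊆ univ.powersetCard j)
    (hcard : #𝒬 + #𝒳 = (M + 1).choose j) (h𝒬n : 𝒬.Nonempty) (hlt : #𝒬 < M.choose j) :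
    (M + 1).choose (j + 1) + (M - j).choose j ≤
      #(disjointSets univ j 𝒬) + #(disjointSets univ (j + 1) 𝒳) := by
  obtain ⟨𝒬₀, h𝒬₀, hc𝒬, hd𝒬, hs𝒬⟩ := exists_card_disjointSets_le (b := j) (by omega) h𝒬
  obtain ⟨𝒳₀, h𝒳₀, hc𝒳, hd𝒳, hs𝒳⟩ := exists_card_disjointSets_le (b := j + 1) (by omega) h𝒳
  refine le_trans ?_ (add_le_add hd𝒬 hd𝒳)
  have hq := h𝒬n.card_pos
  set z := Fin.last M
  set W : Finset (Fin (M + 1)) := univ.erase z with hW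
  have hWc : #W = M := by simp [hW]
  have hsubW : ∀ {E : Finset (Fin (M + 1))}, E ⊆ W ↔ z ∉ E := by
    intro E
    rw [hW, subset_erase]
    simp
  have hWj : #(W.powersetCard j) = M.choose j := by rw [card_powersetCard, hWc]
  have hUj : #((univ : Finset (Fin (M + 1))).powersetCard j) = (M + 1).choose j := by simp
  have hj0 : j ≠ 0 := by
    rintro rfl
    rw [Nat.choose_zero_right] at hlt
    omega
  have hins : Set.InjOn (insert z) {E : Finset (Fin (M + 1)) | z ∉ E} := by
    intro E hE F hF h
    rw [← erase_insert hE, ← erase_insert hF, h]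
  replace hs𝒬 : ∀ F ∈ 𝒬₀, z ∈ F := by
    refine hs𝒬.resolve_right fun h => ?_
    have : (W.powersetCard j).image (insert z) ⊆ 𝒬₀ := by
      intro F hF
      obtain ⟨E, hE, rfl⟩ := mem_image.1 hF
      rw [mem_powersetCard, hsubW] at hE
      exact h _ (by rw [card_insert_of_notMem hE.1, hE.2]) (mem_insert_self _ _)
    have := card_le_card this
    rw [card_image_of_injOn (hins.mono fun E hE => hsubW.1 (mem_powersetCard.1 hE).1), hWj] at this
    omega
  replace hs𝒳 : ∀ F, #F = j → z ∈ F → F ∈ 𝒳₀ := by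
    refine hs𝒳.resolve_left fun h => ?_
    have hdisj : Disjoint 𝒳₀ (W.powersetCard j) := by
      rw [disjoint_left]
      intro F hF hF'
      exact hsubW.1 (mem_powersetCard.1 hF').1 (h F hF)
    have := card_le_card (union_subset h𝒳₀ (powersetCard_mono (n := j) (subset_univ W)))
    rw [card_union_of_disjoint hdisj, hUj, hWj] at this
    omega
  set 𝒬' := 𝒬₀.image (fun F => F.erase z)
  set 𝒳' := {F ∈ 𝒳₀ | z ∉ F}
  have h𝒬' : 𝒬' ⊆ W.powersetCard j := by
    intro E hE
    obtain ⟨F, hF, rfl⟩ := mem_image.1 hE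
    rw [mem_powersetCard, card_erase_of_mem (hs𝒬 F hF), (mem_powersetCard.1 (h𝒬₀ hF)).2]
    exact ⟨erase_subset_erase _ (subset_univ _), rfl⟩
  have h𝒳' : 𝒳' ⊆ W.powersetCard j := by
    intro E hE
    rw [mem_filter] at hE
    exact mem_powersetCard.2 ⟨hsubW.2 hE.2, (mem_powersetCard.1 (h𝒳₀ hE.1)).2⟩
  have hc𝒬' : #𝒬' = #𝒬 := by
    rw [← hc𝒬]
    refine card_image_of_injOn fun F hF G hG h => ?_
    rw [← insert_erase (hs𝒬 F hF), ← insert_erase (hs𝒬 G hG)]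
    exact congrArg (insert z) h
  have hc𝒳' : #𝒬 + #𝒳' = M.choose j := by
    have heq : univ.powersetCard j \ 𝒳₀ = W.powersetCard j \ 𝒳' := by
      ext F
      simp only [𝒳', mem_sdiff, mem_powersetCard, mem_filter, hsubW, subset_univ, true_and]
      have := hs𝒳 F
      tauto
    have h1 := card_sdiff_add_card_eq_card h𝒳₀
    have h2 := card_sdiff_add_card_eq_card h𝒳'
    rw [heq] at h1
    omega
  have key := card_disjointSets_add_card_disjointSets (V := W) (j := j) (by omega) h𝒬' h𝒳'
    (card_pos.1 (by omega)) (card_pos.1 (by omega)) (by rw [hc𝒬', hc𝒳', hWc])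
  rw [hWc] at key
  have hD𝒬 : #(disjointSets W j 𝒬') ≤ #(disjointSets univ j 𝒬₀) := by
    refine card_le_card fun E hE => ?_
    obtain ⟨⟨hEW, hEj⟩, F', hF', hEF⟩ := mem_disjointSets.1 hE
    obtain ⟨F, hF, rfl⟩ := mem_image.1 hF'
    refine mem_disjointSets.2 ⟨⟨subset_univ _, hEj⟩, F, hF, ?_⟩
    rw [← insert_erase (hs𝒬 F hF), disjoint_insert_right]
    exact ⟨hsubW.1 hEW, hEF⟩
  have hD𝒳 : M.choose (j + 1) + #(disjointSets W j 𝒳') ≤ #(disjointSets univ (j + 1) 𝒳₀) := by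
    have hdisj : Disjoint (W.powersetCard (j + 1)) ((disjointSets W j 𝒳').image (insert z)) := by
      rw [disjoint_left]
      intro F hF hF'
      obtain ⟨E, -, rfl⟩ := mem_image.1 hF'
      exact hsubW.1 (mem_powersetCard.1 hF).1 (mem_insert_self _ _)
    have himg : #((disjointSets W j 𝒳').image (insert z)) = #(disjointSets W j 𝒳') :=
      card_image_of_injOn (hins.mono fun E hE => hsubW.1 (mem_disjointSets.1 hE).1.1)
    have hWj : #(W.powersetCard (j + 1)) = M.choose (j + 1) := by
      rw [card_powersetCard, hWc]
    rw [← himg, ← hWj, ← card_union_of_disjoint hdisj]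
    refine card_le_card (union_subset (fun E hE => ?_) fun E' hE' => ?_)
    · rw [mem_powersetCard, hsubW] at hE
      have hEc : #Eᶜ = M - j := by rw [card_compl, Fintype.card_fin, hE.2]; omega
      obtain ⟨F, hzF, hFE, hFj⟩ := exists_subsuperset_card_eq (s := {z}) (t := Eᶜ) (n := j)
        (by simpa using hE.1) (by rw [card_singleton]; omega) (by omega)
      refine mem_disjointSets.2 ⟨⟨subset_univ _, hE.2⟩, F,
        hs𝒳 F hFj (hzF (mem_singleton_self z)), ?_⟩
      exact (disjoint_compl_right (a := E)).mono_right hFE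
    · obtain ⟨E, hE, rfl⟩ := mem_image.1 hE'
      obtain ⟨⟨hEW, hEj⟩, F, hF, hEF⟩ := mem_disjointSets.1 hE
      rw [mem_filter] at hF
      refine mem_disjointSets.2 ⟨⟨subset_univ _, ?_⟩, F, hF.1, ?_⟩
      · rw [card_insert_of_notMem (hsubW.1 hEW), hEj]
      · rw [disjoint_insert_left]
        exact ⟨hF.2, hEF⟩
  rw [Nat.choose_succ_succ']
  omega

lemma card_disjointSets_add_card_disjointSets_succ {α : Type*} [DecidableEq α] {V : Finset α}
    {M j : ℕ} (hV : #V = M + 1) (hj : 2 * j + 1 ≤ M) {𝒬 𝒳 : Finset (Finset α)}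
    (h𝒬 : 𝒬 ⊆ V.powersetCard (j + 1)) (h𝒳 : 𝒳 ⊆ V.powersetCard j)
    (hcard : #𝒬 + #𝒳 = (M + 1).choose j) (h𝒬n : 𝒬.Nonempty) (hlt : #𝒬 < M.choose j) :
    (M + 1).choose (j + 1) + (M - j).choose j ≤
      #(disjointSets V j 𝒬) + #(disjointSets V (j + 1) 𝒳) := by
  obtain ⟨e, rfl⟩ := exists_embedding_map_univ V hV
  have h := card_disjointSets_add_card_disjointSets_fin hj
    (pullback_subset_powersetCard h𝒬) (pullback_subset_powersetCard h𝒳)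
    (by rw [card_pullback h𝒬, card_pullback h𝒳, hcard])
    (card_pos.1 (by rw [card_pullback h𝒬]; exact h𝒬n.card_pos)) (by rwa [card_pullback h𝒬])
  rwa [card_disjointSets_pullback h𝒬, card_disjointSets_pullback h𝒳] at h

/-- Some point of `V` lies in at least the average number of members of a uniform family. -/
lemma exists_card_mul_card_nonMemberSubfamily_le {α : Type*} [DecidableEq α] {V : Finset α}
    (hV : V.Nonempty) {k : ℕ} {𝓑 : Finset (Finset α)} (h𝓑 : 𝓑 ⊆ V.powersetCard k) :
    ∃ x ∈ V, #V * #(𝓑.nonMemberSubfamily x) ≤ (#V - k) * #𝓑 := by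
  have hsum : ∑ x ∈ V, #(𝓑.nonMemberSubfamily x) = ∑ _B ∈ 𝓑, (#V - k) := by
    have h := sum_card_bipartiteAbove_eq_sum_card_bipartiteBelow (s := V) (t := 𝓑)
      (fun x B => x ∉ B)
    refine h.trans (sum_congr rfl fun B hB => ?_)
    have hB' := mem_powersetCard.1 (h𝓑 hB)
    rw [bipartiteBelow, filter_notMem_eq_sdiff, card_sdiff_of_subset hB'.1, hB'.2]
  rw [sum_const, smul_eq_mul] at hsum
  obtain ⟨x, hx, hle⟩ := exists_min_image V (fun x => #(𝓑.nonMemberSubfamily x)) hV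
  refine ⟨x, hx, ?_⟩
  rw [mul_comm _ (#𝓑), ← hsum, ← smul_eq_mul]
  exact card_nsmul_le_sum _ _ _ hle

lemma card_le_of_forall_notMem_disjointSets {α : Type*} [DecidableEq α] {V : Finset α} {b : ℕ}
    {𝓐 𝒬 : Finset (Finset α)} (h𝓐 : 𝓐 ⊆ V.powersetCard b)
    (hcross : ∀ A ∈ 𝓐, ∀ F ∈ 𝒬, ¬ Disjoint A F) :
    #𝓐 + #(disjointSets V b 𝒬) ≤ (#V).choose b := by
  have hdisj : Disjoint 𝓐 (disjointSets V b 𝒬) := by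
    rw [disjoint_left]
    intro A hA hA'
    obtain ⟨-, F, hF, h⟩ := mem_disjointSets.1 hA'
    exact hcross A hA F hF h
  rw [← card_union_of_disjoint hdisj, ← card_powersetCard]
  exact card_le_card (union_subset h𝓐 (filter_subset _ _))

lemma card_add_choose_le {α : Type*} [DecidableEq α] {V : Finset α} {n j : ℕ} (hV : #V = n)
    (hn : 2 * (j + 1) < n) {𝓐 𝓑 : Finset (Finset α)}
    (h𝓐 : 𝓐 ⊆ V.powersetCard (j + 1)) (h𝓑 : 𝓑 ⊆ V.powersetCard (j + 1))
    (hcross : ∀ A ∈ 𝓐, ∀ B ∈ 𝓑, (A ∩ B).Nonempty)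
    (hcard : #𝓑 = (n - 1).choose j) (hempty : ∀ x, ∃ B ∈ 𝓑, x ∉ B) :
    #𝓐 + (n - 1 - (j + 1)).choose j ≤ (n - 1).choose j := by
  obtain ⟨M, rfl⟩ : ∃ M, n = M + 2 := ⟨n - 2, by omega⟩
  obtain ⟨x, hx, hmin⟩ :=
    exists_card_mul_card_nonMemberSubfamily_le (card_pos.1 (by omega)) h𝓑
  simp only [show M + 2 - 1 = M + 1 from rfl, show M + 1 - (j + 1) = M - j by omega] at hcard ⊢
  have hWc : #(V.erase x) = M + 1 := by rw [card_erase_of_mem hx, hV]; rfl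
  have hlink : ∀ {𝓕 : Finset (Finset α)}, 𝓕 ⊆ V.powersetCard (j + 1) →
      𝓕.memberSubfamily x ⊆ (V.erase x).powersetCard j := by
    intro 𝓕 h𝓕 F hF
    rw [mem_memberSubfamily] at hF
    have h := mem_powersetCard.1 (h𝓕 hF.1)
    rw [card_insert_of_notMem hF.2] at h
    exact mem_powersetCard.2 ⟨subset_erase.2 ⟨(subset_insert _ _).trans h.1, hF.2⟩, by omega⟩
  have hdel : ∀ {𝓕 : Finset (Finset α)}, 𝓕 ⊆ V.powersetCard (j + 1) →
      𝓕.nonMemberSubfamily x ⊆ (V.erase x).powersetCard (j + 1) := by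
    intro 𝓕 h𝓕 F hF
    rw [mem_nonMemberSubfamily] at hF
    have h := mem_powersetCard.1 (h𝓕 hF.1)
    exact mem_powersetCard.2 ⟨subset_erase.2 ⟨h.1, hF.2⟩, h.2⟩
  have hsplitA := card_memberSubfamily_add_card_nonMemberSubfamily x 𝓐
  have hsplitB := card_memberSubfamily_add_card_nonMemberSubfamily x 𝓑
  have hlt : #(𝓑.nonMemberSubfamily x) < M.choose j := by
    have hpos : 0 < M.choose j := Nat.choose_pos (by omega)
    have hch : (M + 1 - j) * (M + 1).choose j = (M + 1) * M.choose j := by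
      rw [mul_comm, ← Nat.choose_mul_succ_eq, mul_comm]
    rw [hV, hcard, show M + 2 - (j + 1) = M + 1 - j by omega, hch] at hmin
    by_contra! hle
    have := Nat.mul_le_mul_left (M + 2) hle
    nlinarith
  have key := card_disjointSets_add_card_disjointSets_succ hWc (by omega) (hdel h𝓑) (hlink h𝓑)
    (by omega)
    (by
      obtain ⟨B, hB, hxB⟩ := hempty x
      exact ⟨B, mem_nonMemberSubfamily.2 ⟨hB, hxB⟩⟩) hlt
  have h₁ := card_le_of_forall_notMem_disjointSets (𝒬 := 𝓑.nonMemberSubfamily x) (hlink h𝓐) (by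
    intro A hA B hB h
    rw [mem_memberSubfamily] at hA
    rw [mem_nonMemberSubfamily] at hB
    refine not_disjoint_iff_nonempty_inter.2 (hcross _ hA.1 _ hB.1) ?_
    exact disjoint_insert_left.2 ⟨hB.2, h⟩)
  have h₂ := card_le_of_forall_notMem_disjointSets (𝒬 := 𝓑.memberSubfamily x) (hdel h𝓐) (by
    intro A hA B hB h
    rw [mem_nonMemberSubfamily] at hA
    rw [mem_memberSubfamily] at hB
    refine not_disjoint_iff_nonempty_inter.2 (hcross _ hA.1 _ hB.1) ?_
    exact disjoint_insert_right.2 ⟨hA.2, h⟩)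
  rw [hWc] at h₁ h₂
  omega

end CrossIntersecting

/-- The Mörs-based case of Theorem 1: if `𝓐, 𝓑` are cross-intersecting families
of `k`-subsets of `[n]`, `n > 2k > 0`, `|𝓑| = binom(n-1,k-1)` and the
intersection of all members of `𝓑` is empty, then
`|𝓐| ≤ binom(n-1,k-1) − binom(n-k-1,k-1)`. -/
theorem thm1_special (n k : ℕ) (hk : 0 < k) (hn : 2 * k < n)
    (𝓐 𝓑 : Finset (Finset ℕ))
    (h𝓐 : ∀ A ∈ 𝓐, A ⊆ Finset.Icc 1 n ∧ A.card = k)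
    (h𝓑 : ∀ B ∈ 𝓑, B ⊆ Finset.Icc 1 n ∧ B.card = k)
    (hcross : ∀ A ∈ 𝓐, ∀ B ∈ 𝓑, (A ∩ B).Nonempty)
    (hBcard : 𝓑.card = (n - 1).choose (k - 1))
    (hBint : ∀ x : ℕ, ∃ B ∈ 𝓑, x ∉ B) :
    𝓐.card ≤ (n - 1).choose (k - 1) - (n - k - 1).choose (k - 1) := by
  obtain ⟨j, rfl⟩ : ∃ j, k = j + 1 := ⟨k - 1, by omega⟩
  have h := CrossIntersecting.card_add_choose_le (V := Finset.Icc 1 n) (n := n) (by simp) hn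
    (fun A hA => Finset.mem_powersetCard.2 (h𝓐 A hA))
    (fun B hB => Finset.mem_powersetCard.2 (h𝓑 B hB)) hcross hBcard hBint
  rw [show n - 1 - (j + 1) = n - (j + 1) - 1 by omega] at h
  exact Nat.le_sub_of_add_le h
end

section
/- Let n, l, x be integers with n ≤ 2l, n − l ≥ 2, and l − 2 ≤ x ≤ n − 3. Then binom(x, l-2)·binom(n-2, l) ≤ binom(x, n-l-2)·binom(n-1, l). -/
theorem Nat.choose_mul_succ_le_choose_mul_succ {a b x : ℕ} (hba : b ≤ a) (hax : a ≤ x)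
    (hx : x ≤ a + b + 1) : x.choose a * (b + 1) ≤ x.choose b * (a + 1) := by
  refine Nat.le_of_mul_le_mul_right ?_ (Nat.choose_pos hba)
  have hmono : (x - b).choose (a - b) ≤ (a + 1).choose (b + 1) := by
    rw [← Nat.choose_symm (show b + 1 ≤ a + 1 by omega), Nat.add_sub_add_right]
    exact Nat.choose_le_choose _ (by omega)
  calc x.choose a * (b + 1) * a.choose b
      = x.choose a * a.choose b * (b + 1) := by ring
    _ = x.choose b * ((x - b).choose (a - b) * (b + 1)) := by
      rw [Nat.choose_mul hba, mul_assoc]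
    _ ≤ x.choose b * ((a + 1).choose (b + 1) * (b + 1)) := by gcongr
    _ = x.choose b * (a + 1) * a.choose b := by
      rw [← Nat.add_one_mul_choose_eq, mul_assoc]

/-- Inequality (17): for integers `n ≤ 2l`, `n - l ≥ 2` and `l-2 ≤ x ≤ n-3`,
`binom(x,l-2)·binom(n-2,l) ≤ binom(x,n-l-2)·binom(n-1,l)`. -/
theorem binom_ineq17 (n l x : ℕ) (hn : n ≤ 2 * l) (hnl : 2 ≤ n - l)
    (hx1 : l - 2 ≤ x) (hx2 : x ≤ n - 3) :
    x.choose (l - 2) * (n - 2).choose l ≤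
      x.choose (n - l - 2) * (n - 1).choose l := by
  obtain ⟨a, rfl⟩ : ∃ a, l = a + 2 := ⟨l - 2, by omega⟩
  obtain ⟨b, rfl⟩ : ∃ b, n = a + b + 4 := ⟨n - (a + 4), by omega⟩
  rw [show a + b + 4 - (a + 2) - 2 = b by omega, show a + 2 - 2 = a by omega,
    show a + b + 4 - 2 = a + b + 2 by omega, show a + b + 4 - 1 = a + b + 2 + 1 by omega]
  have hchoose : (a + b + 2).choose (a + 2) * (a + b + 3) =
      (a + b + 3).choose (a + 2) * (b + 1) := by
    have h := Nat.choose_mul_succ_eq (a + b + 2) (a + 2)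
    rwa [show a + b + 2 + 1 - (a + 2) = b + 1 by omega] at h
  have hle := Nat.choose_mul_succ_le_choose_mul_succ (show b ≤ a by omega)
    (show a ≤ x by omega) (show x ≤ a + b + 1 by omega)
  refine Nat.le_of_mul_le_mul_right ?_ b.succ_pos
  calc x.choose a * (a + b + 2).choose (a + 2) * (b + 1)
      = x.choose a * (b + 1) * (a + b + 2).choose (a + 2) := by ring
    _ ≤ x.choose b * (a + 1) * (a + b + 2).choose (a + 2) := by gcongr
    _ ≤ x.choose b * (a + b + 3) * (a + b + 2).choose (a + 2) := by gcongr <;> omega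
    _ = x.choose b * ((a + b + 2).choose (a + 2) * (a + b + 3)) := by ring
    _ = x.choose b * (a + b + 2 + 1).choose (a + 2) * (b + 1) := by rw [hchoose, mul_assoc]
end

section
/- Let n, l be integers with n ≤ 2l and n − l ≥ 2. Then (binom(n-2, l) + binom(n-4, l-1))·(binom(n-1, l) + binom(n-2, l-1)) ≤ (binom(n-1, l) + binom(n-3, l-1))·(binom(n-2, l) + binom(n-3, l-1)). -/
/-- The cleared-denominator form of `binom_ineq_case4`, with `l = a + 1`, `n = a + j + 3` and
`a = j + 1 + d`. -/
lemma binom_ineq_case4_poly {j d a p : ℚ} (hj : 0 ≤ j) (hd : 0 ≤ d) (ha : a = j + 1 + d)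
    (hp : p = a + j) :
    (p * (p + 1) + j * (a + 1)) * ((p + 1) * (p + a + 3)) ≤
      p * (p + a + 2) * ((p + 1) * (p + 2) + (j + 1) * (a + 1)) := by
  subst hp ha
  rw [← sub_nonneg]
  ring_nf
  positivity

theorem binom_ineq_case4 (n l : ℕ) (hn : n ≤ 2 * l) (hnl : 2 ≤ n - l) :
    ((n - 2).choose l + (n - 4).choose (l - 1)) *
        ((n - 1).choose l + (n - 2).choose (l - 1)) ≤
      ((n - 1).choose l + (n - 3).choose (l - 1)) *
        ((n - 2).choose l + (n - 3).choose (l - 1)) := by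
  obtain ⟨j, rfl⟩ : ∃ j, n = l + 2 + j := ⟨n - l - 2, by omega⟩
  obtain ⟨d, rfl⟩ : ∃ d, l = j + 1 + d + 1 := ⟨l - j - 2, by omega⟩
  obtain ⟨a, ha⟩ : ∃ a, a = j + 1 + d := ⟨_, rfl⟩
  obtain ⟨q, hq⟩ : ∃ q, q + 1 = a + j := ⟨j + d + j, by omega⟩
  rw [← ha, show a + 1 + 2 + j - 1 = q + 3 by omega, show a + 1 + 2 + j - 2 = q + 2 by omega,
    show a + 1 + 2 + j - 3 = q + 1 by omega, show a + 1 + 2 + j - 4 = q by omega,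
    Nat.add_sub_cancel]
  have hX := Nat.choose_mul_succ_eq q a
  have hV := Nat.choose_mul_succ_eq (q + 1) a
  have hU := Nat.add_one_mul_choose_eq (q + 1) a
  have hW := Nat.add_one_mul_choose_eq (q + 2) a
  rw [show q + 1 - a = j by omega] at hX
  rw [show q + 1 + 1 - a = j + 1 by omega] at hV
  have haQ : (a : ℚ) = j + 1 + d := by exact_mod_cast ha
  have hqQ : (q : ℚ) + 1 = a + j := by exact_mod_cast hq
  have key := binom_ineq_case4_poly j.cast_nonneg d.cast_nonneg haQ hqQ
  qify at hX hV hU hW ⊢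
  generalize ((q + 1).choose a : ℚ) = Y at *
  have hX' : (q.choose a : ℚ) = Y * j / (q + 1) := by
    rw [eq_div_iff (by positivity), hX]
  have hV' : ((q + 2).choose a : ℚ) = Y * (q + 2) / (j + 1) := by
    rw [eq_div_iff (by positivity)]; linear_combination -hV
  have hU' : ((q + 2).choose (a + 1) : ℚ) = Y * (q + 2) / (a + 1) := by
    rw [eq_div_iff (by positivity)]; linear_combination -hU
  have hW' : ((q + 3).choose (a + 1) : ℚ) = Y * (q + 2) * (q + 3) / ((j + 1) * (a + 1)) := by
    rw [eq_div_iff (by positivity)]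
    rw [hV'] at hW
    field_simp at hW
    linear_combination -hW
  rw [hX', hV', hU', hW', ← sub_nonneg]
  have hdiff := mul_nonneg (div_nonneg (sq_nonneg Y)
    (by positivity : (0 : ℚ) ≤ (q + 1) * (a + 1) ^ 2 * (j + 1))) (sub_nonneg.2 key)
  refine hdiff.trans_eq ?_
  field_simp
  ring
end
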